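/- arXiv:math/0410539 — 2 statements merged into one kernel-verified Lean document; each statement's English description precedes it below -/
import Mathlib

section
/- A cell c of UD^nΓ is critical if and only if c contains no order-respecting edge and every vertex of c is blocked in c. -/
open SimpleGraph

attribute [local instance] Classical.propDecidable

namespace GraphBraid

/-- The degree of a vertex, defined via `Set.ncard` to avoid decidability assumptions. -/
noncomputable def ncdeg {V : Type} (H : SimpleGraph V) (v : V) : ℕ := (H.neighborSet v).ncard

/-- The basic setup: a finite connected simple graph `G` with a spanning tree `T`,
a root `root` of degree one in `T`, and a labelling of the edges of `T` incident to each
vertex `u` by the numbers `0, …, d_T(u) - 1`, where the edge towards the root receives the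
label `0` (and the unique edge at the root receives the label `1`). -/
structure Setup (V : Type) [Fintype V] [DecidableEq V] where
  G : SimpleGraph V
  G_conn : G.Connected
  T : SimpleGraph V
  T_le : T ≤ G
  T_tree : T.IsTree
  root : V
  root_deg : ncdeg T root = 1
  label : V → V → ℕ
  label_bij : ∀ u : V, u ≠ root → Set.BijOn (label u) (T.neighborSet u) (Set.Iio (ncdeg T u))
  label_zero : ∀ u : V, u ≠ root → ∀ w : V, T.Adj u w →
    (label u w = 0 ↔ T.dist root w + 1 = T.dist root u)
  label_root : ∀ w : V, T.Adj root w → label root w = 1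

namespace Setup

variable {V : Type} [Fintype V] [DecidableEq V] (S : Setup V)

/-- The unique geodesic (path) in the tree `T` from `u` to `w`. -/
noncomputable def geod (u w : V) : S.T.Walk u w := (S.T_tree.existsUnique_path u w).choose

/-- `g(u,w)`: the label at `u` of the first edge of the tree geodesic from `u` to `w`,
with `g(u,u) = 0`. -/
noncomputable def gfun (u w : V) : ℕ :=
  if u = w then 0 else S.label u ((S.geod u w).getVert 1)

lemma exists_wedge (u w : V) :
    ∃ x : V, (x ∈ (S.geod S.root u).support ∧ x ∈ (S.geod S.root w).support) ∧
      ∀ y : V, y ∈ (S.geod S.root u).support → y ∈ (S.geod S.root w).support →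
        S.T.dist S.root y ≤ S.T.dist S.root x := by
  classical
  have hne : ((S.geod S.root u).support.toFinset ∩
      (S.geod S.root w).support.toFinset).Nonempty :=
    ⟨S.root, by simp [SimpleGraph.Walk.start_mem_support]⟩
  obtain ⟨x, hx, hmax⟩ := Finset.exists_max_image _ (fun y => S.T.dist S.root y) hne
  simp only [Finset.mem_inter, List.mem_toFinset] at hx hmax
  exact ⟨x, ⟨hx.1, hx.2⟩, fun y h1 h2 => hmax y ⟨h1, h2⟩⟩

/-- `u ∧ w`: the vertex farthest from the root lying on both tree geodesics from the
root to `u` and from the root to `w`. -/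
noncomputable def wedge (u w : V) : V := (S.exists_wedge u w).choose

/-- The order on vertices: `u ≤ w` iff `u ∧ w = u`, or `u ∧ w ≠ u` and
`g(u ∧ w, u) < g(u ∧ w, w)`. -/
def vle (u w : V) : Prop :=
  S.wedge u w = u ∨ (S.wedge u w ≠ u ∧ S.gfun (S.wedge u w) u < S.gfun (S.wedge u w) w)

/-- The associated strict order on vertices. -/
def vlt (u w : V) : Prop := S.vle u w ∧ u ≠ w

/-- `ι(e)`: the larger endpoint of the edge `e` in the vertex order. -/
noncomputable def iota (e : Sym2 V) : V :=
  if S.vle (Quot.out e).1 (Quot.out e).2 then (Quot.out e).2 else (Quot.out e).1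

/-- `τ(e)`: the smaller endpoint of the edge `e` in the vertex order. -/
noncomputable def tau (e : Sym2 V) : V :=
  if S.vle (Quot.out e).1 (Quot.out e).2 then (Quot.out e).1 else (Quot.out e).2

/-- `e(v)`: the edge of `T` incident to `v` lying on the tree geodesic from `v` to the root. -/
noncomputable def eV (v : V) : Sym2 V := s(v, (S.geod v S.root).getVert 1)

/-- A cell of `UD^n Γ`: an `n`-element set whose elements are vertices (encoded as
diagonal elements of `Sym2 V`) and closed edges of `G`, no two distinct elements of which
share a vertex. -/
def IsCell (n : ℕ) (c : Finset (Sym2 V)) : Prop :=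
  c.card = n ∧ (∀ s ∈ c, s.IsDiag ∨ s ∈ S.G.edgeSet) ∧
    ∀ s ∈ c, ∀ t ∈ c, s ≠ t → ∀ x : V, x ∈ s → x ∉ t

/-- The dimension of a cell: the number of edges it contains. -/
noncomputable def dim (c : Finset (Sym2 V)) : ℕ := (c.filter (fun s => ¬ s.IsDiag)).card

/-- A vertex `v` is blocked in `c` if `v` is the root, or `e(v)` shares a vertex with some
element of `c` other than `v`. -/
def Blocked (c : Finset (Sym2 V)) (v : V) : Prop :=
  v = S.root ∨ ∃ s ∈ c, s ≠ Sym2.diag v ∧ ∃ x : V, x ∈ S.eV v ∧ x ∈ s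

/-- A vertex `v` is unblocked in `c` if it belongs to `c` and is not blocked. -/
def Unblocked (c : Finset (Sym2 V)) (v : V) : Prop := Sym2.diag v ∈ c ∧ ¬ S.Blocked c v

/-- The elementary reduction of `c` from the vertex `v`: replace `v` by the edge `e(v)`. -/
noncomputable def redFrom (c : Finset (Sym2 V)) (v : V) : Finset (Sym2 V) :=
  insert (S.eV v) (c.erase (Sym2.diag v))

/-- `c'` is the principal elementary reduction of `c`: it is the elementary reduction of `c`
from the smallest unblocked vertex of `c`. -/
def PrincipalRedOf (c c' : Finset (Sym2 V)) : Prop :=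
  ∃ v : V, S.Unblocked c v ∧ (∀ u : V, S.Unblocked c u → S.vle v u) ∧ c' = S.redFrom c v

/-- Auxiliary definition of redundancy, by induction on the dimension: a cell of
dimension `i` is redundant iff it has an unblocked vertex and it is not the principal
elementary reduction of a redundant cell of dimension `i - 1`. -/
def RedundantAux (n : ℕ) : ℕ → Finset (Sym2 V) → Prop
  | 0, c => ∃ v, S.Unblocked c v
  | (i + 1), c => (∃ v, S.Unblocked c v) ∧
      ¬ ∃ c₀, S.IsCell n c₀ ∧ dim c₀ = i ∧ RedundantAux n i c₀ ∧ S.PrincipalRedOf c₀ c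

/-- A cell is redundant if the discrete vector field `W` is defined on it. -/
def Redundant (n : ℕ) (c : Finset (Sym2 V)) : Prop := S.RedundantAux n (dim c) c

/-- A cell is collapsible if it lies in the image of `W`. -/
def Collapsible (n : ℕ) (c : Finset (Sym2 V)) : Prop :=
  ∃ c₀, S.IsCell n c₀ ∧ S.Redundant n c₀ ∧ S.PrincipalRedOf c₀ c

/-- A cell is critical if it is neither redundant nor collapsible. -/
def Critical (n : ℕ) (c : Finset (Sym2 V)) : Prop :=
  ¬ S.Redundant n c ∧ ¬ S.Collapsible n c

/-- An edge `e` of the cell `c` is order-respecting in `c` if `e` lies in `T` and every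
vertex `v ∈ c` such that `e(v)` and `e` share the vertex `τ(e)` satisfies `v > ι(e)`. -/
def OrderResp (c : Finset (Sym2 V)) (e : Sym2 V) : Prop :=
  e ∈ c ∧ e ∈ S.T.edgeSet ∧
    ∀ v : V, v ≠ S.root → Sym2.diag v ∈ c → S.tau e ∈ S.eV v → S.vlt (S.iota e) v

/-- `e` is the minimal order-respecting edge of `c`. -/
def MinOrderResp (c : Finset (Sym2 V)) (e : Sym2 V) : Prop :=
  S.OrderResp c e ∧ ∀ e' : Sym2 V, S.OrderResp c e' → S.vle (S.iota e) (S.iota e')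

/-- `c'` is a face of `c` obtained by replacing one edge of `c` by one of its endpoints. -/
def IsFace (c' c : Finset (Sym2 V)) : Prop :=
  ∃ (e : Sym2 V) (x : V), e ∈ c ∧ ¬ e.IsDiag ∧ x ∈ e ∧ c' = insert (Sym2.diag x) (c.erase e)

/-- `Γ` is sufficiently subdivided for `n`: every path between distinct vertices of degree
`≠ 2` passes through at least `n - 1` edges, and every cycle has length at least `n + 1`. -/
def SuffSubdiv (n : ℕ) : Prop :=
  (∀ u v : V, u ≠ v → ncdeg S.G u ≠ 2 → ncdeg S.G v ≠ 2 →
    ∀ p : S.G.Walk u v, p.IsPath → n - 1 ≤ p.length) ∧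
  (∀ v : V, ∀ p : S.G.Walk v v, p.IsCycle → n + 1 ≤ p.length)

/-! ### Helper lemmas for the proof -/

lemma geod_isPath (u w : V) : (S.geod u w).IsPath :=
  (S.T_tree.existsUnique_path u w).choose_spec.1

lemma eq_geod {u w : V} (p : S.T.Walk u w) (hp : p.IsPath) : p = S.geod u w :=
  (S.T_tree.existsUnique_path u w).choose_spec.2 p hp

lemma geod_length (u w : V) : (S.geod u w).length = S.T.dist u w := by
  obtain ⟨p, hp, hl⟩ := S.T_tree.1.exists_path_of_dist u w
  rw [← S.eq_geod p hp, hl]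

lemma geod_append {u w x : V} (h : x ∈ (S.geod u w).support) :
    S.geod u w = (S.geod u x).append (S.geod x w) := by
  obtain ⟨q, r, hq, hr, hqr⟩ := (S.geod_isPath u w).mem_support_iff_exists_append.1 h
  rw [hqr, ← S.eq_geod q hq, ← S.eq_geod r hr]

/-- The labels read along a walk. -/
def labels {u w : V} : S.T.Walk u w → List ℕ
  | .nil => []
  | .cons (v := b) _ p => S.label u b :: labels p

lemma labels_append {u v w : V} (p : S.T.Walk u v) (q : S.T.Walk v w) :
    S.labels (p.append q) = S.labels p ++ S.labels q := by
  induction p with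
  | nil => simp [labels]
  | cons h p ih => simp [labels, ih]

/-- The sequence of labels on the geodesic from the root. -/
noncomputable def code (v : V) : List ℕ := S.labels (S.geod S.root v)

lemma labels_head {u w : V} (p : S.T.Walk u w) (h : u ≠ w) :
    ∃ l, S.labels p = S.label u (p.getVert 1) :: l := by
  cases p with
  | nil => exact absurd rfl h
  | cons h p => exact ⟨S.labels p, by simp [labels]⟩

lemma code_of_mem {u x : V} (h : x ∈ (S.geod S.root u).support) :
    S.code u = S.code x ++ S.labels (S.geod x u) := by
  unfold code
  rw [S.geod_append h, labels_append]

lemma labels_geod {x u : V} (h : x ≠ u) :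
    ∃ l, S.labels (S.geod x u) = S.gfun x u :: l := by
  obtain ⟨l, hl⟩ := S.labels_head (S.geod x u) h
  exact ⟨l, by rw [hl, gfun, if_neg h]⟩

lemma vlt_code {u w : V} (h : S.vlt u w) : S.code u < S.code w := by
  obtain ⟨h, hne⟩ := h
  have hs := (S.exists_wedge u w).choose_spec.1
  change S.wedge u w ∈ _ ∧ S.wedge u w ∈ _ at hs
  unfold vle at h
  generalize S.wedge u w = x at h hs
  rcases h with rfl | ⟨hxu, hlt⟩
  · rw [S.code_of_mem hs.2]
    obtain ⟨l, hl⟩ := S.labels_geod hne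
    rw [hl]
    have := List.append_left_lt (l₁ := S.code x) (List.nil_lt_cons (S.gfun x w) l)
    simpa using this
  · have hxw : x ≠ w := by
      rintro rfl
      simp [gfun] at hlt
    obtain ⟨l, hl⟩ := S.labels_geod hxu
    obtain ⟨m, hm⟩ := S.labels_geod hxw
    rw [S.code_of_mem hs.1, S.code_of_mem hs.2, hl, hm]
    exact List.append_left_lt (List.cons_lt_cons_iff.2 (Or.inl hlt))

/-- The parent of a vertex. -/
noncomputable def par (v : V) : V := (S.geod v S.root).getVert 1

lemma eV_eq (v : V) : S.eV v = s(v, S.par v) := rfl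

lemma adj_par {v : V} (h : v ≠ S.root) : S.T.Adj v (S.par v) :=
  Walk.adj_snd (Walk.not_nil_of_ne h)

lemma par_mem (v : V) : S.par v ∈ (S.geod S.root v).support := by
  have h := S.eq_geod (S.geod v S.root).reverse (S.geod_isPath v S.root).reverse
  rw [← h, Walk.support_reverse, List.mem_reverse]
  exact Walk.getVert_mem_support _ _

lemma eq_of_dist_le {x p : V} (hx : x ∈ (S.geod S.root p).support)
    (h : S.T.dist S.root p ≤ S.T.dist S.root x) : x = p := by
  have h1 := congrArg Walk.length (S.geod_append hx)
  rw [Walk.length_append, S.geod_length, S.geod_length] at h1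
  exact Walk.eq_of_length_eq_zero (p := S.geod x p) (by omega)

lemma wedge_par_left (v : V) : S.wedge (S.par v) v = S.par v := by
  have hs := (S.exists_wedge (S.par v) v).choose_spec
  exact S.eq_of_dist_le hs.1.1 (hs.2 _ (Walk.end_mem_support _) (S.par_mem v))

lemma wedge_par_right (v : V) : S.wedge v (S.par v) = S.par v := by
  have hs := (S.exists_wedge v (S.par v)).choose_spec
  exact S.eq_of_dist_le hs.1.2 (hs.2 _ (S.par_mem v) (Walk.end_mem_support _))

lemma vle_par (v : V) : S.vle (S.par v) v := Or.inl (S.wedge_par_left v)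

lemma not_vle_par {v : V} (h : v ≠ S.root) : ¬ S.vle v (S.par v) := by
  have hne := (S.adj_par h).ne
  unfold vle
  rw [wedge_par_right]
  simp [gfun, hne.symm]

lemma iota_tau_eV {v : V} (h : v ≠ S.root) :
    S.iota (S.eV v) = v ∧ S.tau (S.eV v) = S.par v := by
  have h1 : s((Quot.out (S.eV v)).1, (Quot.out (S.eV v)).2) = s(v, S.par v) := by
    rw [← eV_eq]
    exact Quot.out_eq (S.eV v)
  unfold iota tau
  rcases Sym2.eq_iff.1 h1 with ⟨ha, hb⟩ | ⟨ha, hb⟩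
  · rw [ha, hb, if_neg (S.not_vle_par h), if_neg (S.not_vle_par h)]
    exact ⟨rfl, rfl⟩
  · rw [ha, hb, if_pos (S.vle_par v), if_pos (S.vle_par v)]
    exact ⟨rfl, rfl⟩

lemma par_of_adj {a b : V} (h : S.T.Adj a b) : S.par a = b ∨ S.par b = a := by
  by_cases ha : a ∈ (S.geod b S.root).support
  · right
    have h1 : Walk.cons h.symm Walk.nil = S.geod b a :=
      S.eq_geod _ (by simp [h.ne.symm])
    unfold par
    rw [S.geod_append ha, ← h1]
    simp
  · left
    have h1 : Walk.cons h (S.geod b S.root) = S.geod a S.root :=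
      S.eq_geod _ (by simp [ha, S.geod_isPath])
    unfold par
    rw [← h1]
    simp

lemma par_root : S.par S.root = S.root := by
  have h1 : Walk.nil = S.geod S.root S.root := S.eq_geod _ (by simp)
  unfold par
  rw [← h1]
  simp

lemma edge_eq_eV {e : Sym2 V} (he : e ∈ S.T.edgeSet) : ∃ v, v ≠ S.root ∧ S.eV v = e := by
  induction e with
  | h a b =>
    have hadj : S.T.Adj a b := he
    rcases S.par_of_adj hadj with h | h
    · refine ⟨a, ?_, by rw [eV_eq, h]⟩
      rintro rfl
      exact hadj.ne (S.par_root.symm.trans h)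
    · refine ⟨b, ?_, by rw [eV_eq, h, Sym2.eq_swap]⟩
      rintro rfl
      exact hadj.ne (h.symm.trans S.par_root)

lemma mem_eV_self (v : V) : v ∈ S.eV v := by simp [eV_eq]

lemma mem_redFrom {c : Finset (Sym2 V)} {v : V} {s : Sym2 V} :
    s ∈ S.redFrom c v ↔ s = S.eV v ∨ (s ≠ Sym2.diag v ∧ s ∈ c) := by
  simp [redFrom]

lemma mem_diag_iff {x v : V} : x ∈ Sym2.diag v ↔ x = v := by
  simp [Sym2.diag]

lemma diag_ne {u v : V} (h : u ≠ v) : Sym2.diag u ≠ Sym2.diag v := by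
  simpa [Sym2.diag] using h

lemma diag_ne_eV {u v : V} (h : v ≠ S.root) : Sym2.diag u ≠ S.eV v := by
  intro h1
  have h2 : (S.eV v).IsDiag := h1 ▸ Sym2.diag_isDiag u
  rw [eV_eq, Sym2.mk_isDiag_iff] at h2
  exact (S.adj_par h).ne h2

lemma orderResp_of_red {n : ℕ} {c₀ : Finset (Sym2 V)} (hc : S.IsCell n c₀) {v : V}
    (hv : S.Unblocked c₀ v) (hmin : ∀ u, S.Unblocked c₀ u → S.vle v u) :
    v ≠ S.root ∧ S.OrderResp (S.redFrom c₀ v) (S.eV v) := by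
  have hroot : v ≠ S.root := fun h => hv.2 (Or.inl h)
  have hno : ∀ s ∈ c₀, s ≠ Sym2.diag v → ∀ x, x ∈ S.eV v → x ∉ s :=
    fun s hs hne x hx hxs => hv.2 (Or.inr ⟨s, hs, hne, x, hx, hxs⟩)
  refine ⟨hroot, S.mem_redFrom.2 (Or.inl rfl), S.adj_par hroot, ?_⟩
  intro w hw hwc hτ
  obtain ⟨hi, ht⟩ := S.iota_tau_eV hroot
  rw [ht, eV_eq, Sym2.mem_iff] at hτ
  rw [hi]
  rcases S.mem_redFrom.1 hwc with h | ⟨hne, hmem⟩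
  · exact absurd h (S.diag_ne_eV hroot)
  have hvw : v ≠ w := by rintro rfl; exact hne rfl
  rcases hτ with h | h
  · exact absurd (mem_diag_iff.2 h) (hno _ hmem hne _ (by simp [eV_eq]))
  refine ⟨hmin w ⟨hmem, ?_⟩, hvw⟩
  rintro (h' | ⟨s, hs, hsw, x, hx, hxs⟩)
  · exact hw h'
  rw [eV_eq, Sym2.mem_iff, ← h] at hx
  rcases hx with rfl | rfl
  · exact hc.2.2 _ hs _ hmem hsw x hxs (mem_diag_iff.2 rfl)
  · by_cases hsv : s = Sym2.diag v
    · subst hsv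
      exact (S.adj_par hroot).ne (mem_diag_iff.1 hxs).symm
    · exact hno s hs hsv _ (by simp [eV_eq]) hxs

lemma collapsible_of {n : ℕ} {c : Finset (Sym2 V)} (hc : S.IsCell n c)
    (hb : ∀ v : V, Sym2.diag v ∈ c → S.Blocked c v) (he : ∃ e, S.OrderResp c e) :
    S.Collapsible n c := by
  obtain ⟨v, ⟨hroot, hv⟩, hvmin⟩ : ∃ v, (v ≠ S.root ∧ S.OrderResp c (S.eV v)) ∧
      ∀ w, w ≠ S.root ∧ S.OrderResp c (S.eV w) → S.code v ≤ S.code w := by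
    have hne : (Finset.univ.filter
        (fun v => v ≠ S.root ∧ S.OrderResp c (S.eV v))).Nonempty := by
      obtain ⟨e, he⟩ := he
      obtain ⟨v, hv, rfl⟩ := S.edge_eq_eV he.2.1
      exact ⟨v, by simp [hv, he]⟩
    obtain ⟨v, h1, h2⟩ := Finset.exists_min_image _ (fun v => S.code v) hne
    refine ⟨v, by simpa using h1, fun w hw => h2 w (by simpa using hw)⟩
  obtain ⟨hi, ht⟩ := S.iota_tau_eV hroot
  obtain ⟨hec, -, hor⟩ := hv
  rw [hi, ht] at hor
  -- elements of `c` other than `e(v)` do not touch it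
  have hno : ∀ s ∈ c, s ≠ S.eV v → ∀ x, x ∈ S.eV v → x ∉ s :=
    fun s hs hne x hx => hc.2.2 _ hec _ hs hne.symm x hx
  have hvc : Sym2.diag v ∉ c := fun h =>
    hno _ h (S.diag_ne_eV hroot) v (S.mem_eV_self v) (mem_diag_iff.2 rfl)
  set c₀ := insert (Sym2.diag v) (c.erase (S.eV v)) with hc₀
  have hmem : ∀ s, s ∈ c₀ ↔ s = Sym2.diag v ∨ (s ≠ S.eV v ∧ s ∈ c) := by
    intro s; simp [hc₀]
  have hcell : S.IsCell n c₀ := by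
    refine ⟨?_, ?_, ?_⟩
    · rw [hc₀, Finset.card_insert_of_notMem (by simp [hvc]), Finset.card_erase_of_mem hec, hc.1]
      have := Finset.card_pos.2 ⟨_, hec⟩
      rw [hc.1] at this
      omega
    · intro s hs
      rcases (hmem s).1 hs with rfl | ⟨-, h⟩
      · exact Or.inl (Sym2.diag_isDiag v)
      · exact hc.2.1 s h
    · intro s hs t ht' hst x hxs hxt
      rcases (hmem s).1 hs with rfl | ⟨hs1, hs2⟩ <;> rcases (hmem t).1 ht' with rfl | ⟨ht1, ht2⟩
      · exact hst rfl
      · rw [mem_diag_iff.1 hxs] at hxt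
        exact hno t ht2 ht1 v (S.mem_eV_self v) hxt
      · rw [mem_diag_iff.1 hxt] at hxs
        exact hno s hs2 hs1 v (S.mem_eV_self v) hxs
      · exact hc.2.2 s hs2 t ht2 hst x hxs hxt
  have hunb : S.Unblocked c₀ v := by
    refine ⟨(hmem _).2 (Or.inl rfl), ?_⟩
    rintro (h | ⟨s, hs, hsv, x, hx, hxs⟩)
    · exact hroot h
    · rcases (hmem s).1 hs with rfl | ⟨h1, h2⟩
      · exact hsv rfl
      · exact hno s h2 h1 x hx hxs
  have hnot : ∀ c₁, S.IsCell n c₁ → ¬ S.PrincipalRedOf c₁ c₀ := by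
    rintro c₁ hc₁ ⟨w, hw, hwmin, hred⟩
    obtain ⟨hwroot, how⟩ := S.orderResp_of_red hc₁ hw hwmin
    rw [← hred] at how
    have hwv : w ≠ v := by
      rintro rfl
      rcases (hmem _).1 how.1 with h | h
      · exact S.diag_ne_eV hwroot h.symm
      · exact h.1 rfl
    have h1 : S.OrderResp c (S.eV w) := by
      refine ⟨?_, how.2.1, fun u hu huc => how.2.2 u hu ((hmem _).2 (Or.inr ⟨S.diag_ne_eV hroot, huc⟩))⟩
      rcases (hmem _).1 how.1 with h | h
      · exact absurd h.symm (S.diag_ne_eV hwroot)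
      · exact h.2
    have h2 := hvmin w ⟨hwroot, h1⟩
    refine absurd (S.vlt_code ⟨hwmin v ⟨?_, ?_⟩, hwv⟩) (not_lt.2 h2)
    · have := hunb.1
      rw [hred, S.mem_redFrom] at this
      rcases this with h | h
      · exact absurd h (S.diag_ne_eV hwroot)
      · exact h.2
    · rintro (h | ⟨s, hs, hsv, x, hx, hxs⟩)
      · exact hroot h
      · by_cases hsw : s = Sym2.diag w
        · subst hsw
          rw [mem_diag_iff.1 hxs] at hx
          exact hunb.2 (Or.inr ⟨_, how.1, (S.diag_ne_eV hwroot).symm, w, hx, S.mem_eV_self w⟩)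
        · refine hunb.2 (Or.inr ⟨s, ?_, hsv, x, hx, hxs⟩)
          rw [hred, S.mem_redFrom]
          exact Or.inr ⟨hsw, hs⟩
  refine ⟨c₀, hcell, ?_, v, hunb, ?_, ?_⟩
  · unfold Redundant
    cases dim c₀ with
    | zero => exact ⟨v, hunb⟩
    | succ i => exact ⟨⟨v, hunb⟩, fun ⟨c₁, h1, _, _, h4⟩ => hnot c₁ h1 h4⟩
  · intro u hu
    by_cases huv : u = v
    · subst huv
      have : S.wedge u u = u := by
        have hs := (S.exists_wedge u u).choose_spec
        exact S.eq_of_dist_le hs.1.1 (hs.2 _ (Walk.end_mem_support _) (Walk.end_mem_support _))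
      exact Or.inl this
    have huc : Sym2.diag u ∈ c := by
      rcases (hmem _).1 hu.1 with h | h
      · exact absurd h (diag_ne huv)
      · exact h.2
    have huroot : u ≠ S.root := fun h => hu.2 (Or.inl h)
    rcases hb u huc with h | ⟨s, hs, hsu, x, hx, hxs⟩
    · exact absurd h huroot
    by_cases hse : s = S.eV v
    · subst hse
      rw [eV_eq, Sym2.mem_iff] at hxs
      rcases hxs with rfl | rfl
      · exact absurd (Or.inr ⟨_, hunb.1, diag_ne (Ne.symm huv), x, hx, mem_diag_iff.2 rfl⟩) hu.2
      · exact (hor u huroot huc hx).1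
    · exact absurd (Or.inr ⟨s, (hmem s).2 (Or.inr ⟨hse, hs⟩), hsu, x, hx, hxs⟩) hu.2
  · ext s
    rw [S.mem_redFrom, hmem]
    constructor
    · intro hs
      by_cases h : s = S.eV v
      · exact Or.inl h
      · exact Or.inr ⟨fun h' => hvc (h' ▸ hs), Or.inr ⟨h, hs⟩⟩
    · rintro (rfl | ⟨h1, h2 | h2⟩)
      · exact hec
      · exact absurd h2 h1
      · exact h2.2

end Setup

/-- **Classification theorem, critical cells.**  A cell is critical iff it contains no
order-respecting edge and all of its vertices are blocked. -/
theorem stmt3 {V : Type} [Fintype V] [DecidableEq V] (S : Setup V) (n : ℕ) (hn : 1 ≤ n) (hsub : S.SuffSubdiv n)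
    (c : Finset (Sym2 V)) (hc : S.IsCell n c) :
    S.Critical n c ↔
      ((¬ ∃ e : Sym2 V, S.OrderResp c e) ∧ ∀ v : V, Sym2.diag v ∈ c → S.Blocked c v) := by
  constructor
  · rintro ⟨hr, hcol⟩
    have hb : ∀ v : V, Sym2.diag v ∈ c → S.Blocked c v := by
      intro v hv
      by_contra hnb
      have hunb : ∃ v, S.Unblocked c v := ⟨v, hv, hnb⟩
      apply hr
      unfold Setup.Redundant
      cases hd : Setup.dim c with
      | zero => exact hunb
      | succ i =>
        refine ⟨hunb, ?_⟩
        rintro ⟨c₀, h1, h2, h3, h4⟩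
        refine hcol ⟨c₀, h1, ?_, h4⟩
        unfold Setup.Redundant
        rw [h2]
        exact h3
    exact ⟨fun he => hcol (S.collapsible_of hc hb he), hb⟩
  · rintro ⟨hno, hb⟩
    refine ⟨?_, ?_⟩
    · intro hr
      unfold Setup.Redundant at hr
      have hunb : ∃ v, S.Unblocked c v := by
        cases hd : Setup.dim c with
        | zero => rw [hd] at hr; exact hr
        | succ i => rw [hd] at hr; exact hr.1
      obtain ⟨v, h1, h2⟩ := hunb
      exact h2 (hb v h1)
    · rintro ⟨c₀, hc₀, -, v, hv, hmin, rfl⟩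
      exact hno ⟨_, (S.orderResp_of_red hc₀ hv hmin).2⟩

end GraphBraid
end

section
/- Let Γ be a finite tree (a finite connected acyclic simple graph) with exactly one vertex of degree at least 3, and let d ≥ 3 be the degree of that vertex. Then for every n ≥ 1, the braid group B_n|Γ| = π₁(UC^n(|Γ|)) is a free group of rank Σ_{i=2}^{d−1} [ C(n+d−2, n−1) − C(n+d−i−1, n−1) ], where C(a,b) denotes the binomial coefficient a choose b. -/
open unitInterval

namespace GraphBraid

/-- Index type for the geometric realization: ordered pairs of adjacent vertices. -/
def EdgeIdx {V : Type} (G : SimpleGraph V) : Type := {p : V × V // G.Adj p.1 p.2}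

/-- The gluing relation for the geometric realization: the point `t` of the copy of
`[0,1]` indexed by `(u,v)` is identified with the point `1 - t` of the copy indexed by
`(v,u)`, and the point `0` of the copy indexed by `(u,v)` is identified with the point `0`
of the copy indexed by `(u,w)`. -/
def GlueRel {V : Type} (G : SimpleGraph V) :
    (Σ _ : EdgeIdx G, I) → (Σ _ : EdgeIdx G, I) → Prop := fun x y =>
  ((x.1.1.1 = y.1.1.2 ∧ x.1.1.2 = y.1.1.1 ∧ (x.2 : ℝ) = 1 - (y.2 : ℝ)) ∨
    (x.1.1.1 = y.1.1.1 ∧ (x.2 : ℝ) = 0 ∧ (y.2 : ℝ) = 0))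

/-- The geometric realization of a finite simple graph. -/
abbrev Realization {V : Type} (G : SimpleGraph V) : Type := Quot (GlueRel G)

/-- The relation identifying injective tuples that differ by a permutation of the
coordinates. -/
def PermRel (n : ℕ) (X : Type) : {f : Fin n → X // Function.Injective f} →
    {f : Fin n → X // Function.Injective f} → Prop := fun x y =>
  ∃ p : Equiv.Perm (Fin n), (x : Fin n → X) ∘ p = (y : Fin n → X)

/-- The unordered configuration space of `n` points in the topological space `X`. -/
abbrev UConf (n : ℕ) (X : Type) [TopologicalSpace X] : Type := Quot (PermRel n X)

end GraphBraid

section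
open unitInterval
namespace GraphBraid
open Topology CategoryTheory

section Holonomy

variable {Y : Type} [TopologicalSpace Y] {X : Type} [Group X]

/-- The transition data of a principal bundle over a space covered by two open sets. -/
noncomputable def holCore [TopologicalSpace X] [DiscreteTopology X] (O : Bool → Set Y)
    (hO : ∀ b, IsOpen (O b)) (idx : Y → Bool) (hidx : ∀ y, y ∈ O (idx y)) (s : Bool → Y → X)
    (hs : ∀ y, (∀ b, y ∈ O b) → ∀ b, ∀ᶠ z in 𝓝 y, s b z = s b y) :
    FiberBundleCore Bool Y X where
  baseSet := O
  isOpen_baseSet := hO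
  indexAt := idx
  mem_baseSet_at := hidx
  coordChange i j y h := s j y * (s i y)⁻¹ * h
  coordChange_self i y _ h := by simp
  continuousOn_coordChange i j := by
    by_cases hij : i = j
    · subst hij
      simpa using continuousOn_snd
    · rintro ⟨y, h⟩ ⟨⟨hy1, hy2⟩, -⟩
      have hy : ∀ b, y ∈ O b := by
        intro b
        cases i <;> cases j <;> cases b <;> simp_all
      have h1 : ∀ᶠ p : Y × X in 𝓝 (y, h), s j y * (s i y)⁻¹ * p.2 = s j p.1 * (s i p.1)⁻¹ * p.2 := by
        have := ((hs y hy i).and (hs y hy j))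
        have := (continuous_fst (X := Y) (Y := X)).continuousAt (x := (y, h)) |>.eventually this
        filter_upwards [this] with p hp
        rw [hp.1, hp.2]
      refine ContinuousAt.continuousWithinAt ?_
      refine ContinuousAt.congr ?_ h1
      exact (continuous_of_discreteTopology (f := fun x : X => s j y * (s i y)⁻¹ * x)).continuousAt.comp
        continuousAt_snd
  coordChange_comp i j k y _ h := by group

theorem exists_holonomy (O : Bool → Set Y)
    (hO : ∀ b, IsOpen (O b)) (hcov : ∀ y, ∃ b, y ∈ O b) (s : Bool → Y → X)
    (hs : ∀ y, (∀ b, y ∈ O b) → ∀ b, ∀ᶠ z in 𝓝 y, s b z = s b y) :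
    ∃ Hol : ∀ x y : Y, Path.Homotopic.Quotient x y → X,
      (∀ x, Hol x x (.refl x) = 1) ∧
      (∀ x y z (p : Path.Homotopic.Quotient x y) (q : Path.Homotopic.Quotient y z),
        Hol x z (p.trans q) = Hol y z q * Hol x y p) ∧
      (∀ b x y (γ : Path x y), (∀ t, γ t ∈ O b) → Hol x y ⟦γ⟧ = (s b y)⁻¹ * s b x) := by
  classical
  choose idx hidx using hcov
  let _ : TopologicalSpace X := ⊥
  have _ : DiscreteTopology X := ⟨rfl⟩
  let Z := holCore O hO idx hidx s hs
  have cov : IsCoveringMap (Bundle.TotalSpace.proj : Z.TotalSpace → Y) :=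
    FiberBundle.isCoveringMap (F := X) (E := Z.Fiber)
  let mk : ∀ y : Y, X → (Bundle.TotalSpace.proj : Z.TotalSpace → Y) ⁻¹' {y} :=
    fun y h => ⟨⟨y, (s (idx y) y * h : X)⟩, rfl⟩
  let cd : Z.TotalSpace → X := fun e => (s (idx e.1) e.1)⁻¹ * (show X from e.2)
  have mk_cd : ∀ y (e : (Bundle.TotalSpace.proj : Z.TotalSpace → Y) ⁻¹' {y}), mk y (cd e.1) = e := by
    rintro y ⟨⟨y', h⟩, rfl⟩
    apply Subtype.ext
    simp only [mk, cd]
    congr 1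
    exact mul_inv_cancel_left (G := X) _ _
  have cd_mk : ∀ y h, cd (mk y h).1 = h := by
    intro y h
    exact inv_mul_cancel_left _ _
  let R : X → Z.TotalSpace → Z.TotalSpace := fun g e => ⟨e.1, ((show X from e.2) * g : X)⟩
  have hR : ∀ g, Continuous (R g) := by
    intro g
    rw [continuous_iff_continuousAt]
    intro e
    rw [FiberBundle.continuousAt_totalSpace X]
    refine ⟨(FiberBundle.continuous_proj X Z.Fiber).continuousAt, ?_⟩
    have h1 := ((FiberBundle.continuousAt_totalSpace X (f := (id : Z.TotalSpace → Z.TotalSpace)) (x₀ := e)).1 continuousAt_id).2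
    have h2 : ContinuousAt (fun x : X => x * g) ((trivializationAt X Z.Fiber (id e).proj (id e)).2) :=
      continuous_of_discreteTopology.continuousAt
    have h3 := ContinuousAt.comp (g := fun x : X => x * g)
      (f := fun x => (trivializationAt X Z.Fiber (id e).proj (id x)).2) h2 h1
    refine h3.congr (Filter.Eventually.of_forall fun z => ?_)
    change (s _ _ * (s _ _)⁻¹ * _) * g = s _ _ * (s _ _)⁻¹ * (_ * g)
    exact mul_assoc _ _ _
  have mono_R : ∀ x y (p : Path.Homotopic.Quotient x y) (g h : X),
      (cd (cov.monodromy p (mk x (h * g))).1) = cd (cov.monodromy p (mk x h)).1 * g := by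
    intro x y p g h
    let e1 := cov.monodromy p (mk x h)
    have key : cov.monodromy p (mk x (h * g)) = ⟨R g e1.1, e1.2⟩ := by
      have hpre : (mk x (h * g)).1 = R g (mk x h).1 := by
        simp only [mk, R]
        congr 1
        exact (mul_assoc (G := X) _ _ _).symm
      apply cov.monodromy_eq_of_map_eq
        (((cov.liftPathQuotient p (mk x h)).map ⟨R g, hR g⟩).cast hpre rfl)
      have h3 := cov.map_liftPathQuotient p (mk x h)
      revert h3
      generalize cov.liftPathQuotient p (mk x h) = q
      obtain ⟨q⟩ := q
      obtain ⟨p⟩ := p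
      intro h3
      exact h3
    rw [key]
    change (s _ _)⁻¹ * (_ * g) = (s _ _)⁻¹ * _ * g
    exact (mul_assoc _ _ _).symm
  refine ⟨fun x y p => cd (cov.monodromy p (mk x 1)).1, ?_, ?_, ?_⟩
  · intro x
    simp only
    rw [cov.monodromy_refl]
    exact cd_mk _ _
  · intro x y z p q
    simp only
    rw [cov.monodromy_trans_apply, ← mono_R, one_mul, mk_cd]
  · intro b x y γ hγ
    simp only
    let Γ : I → Z.TotalSpace := fun t => (Z.localTriv b).toPartialEquiv.symm (γ t, s b x)
    have hΓc : Continuous Γ := by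
      rw [continuous_iff_continuousAt]
      intro t
      have h1 : ContinuousAt (Z.localTriv b).toOpenPartialHomeomorph.symm (γ t, s b x) := by
        apply (Z.localTriv b).toOpenPartialHomeomorph.continuousAt_symm
        rw [(Z.localTriv b).target_eq]
        exact ⟨hγ t, trivial⟩
      exact ContinuousAt.comp (f := fun t => (γ t, s b x)) h1 (by fun_prop)
    have hΓ : ∀ t, Γ t = ⟨γ t, (s (idx (γ t)) (γ t) * (s b (γ t))⁻¹ * s b x : X)⟩ := fun t => rfl
    have hm : cov.monodromy ⟦γ⟧ (mk x 1) = mk y ((s b y)⁻¹ * s b x) := by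
      have h0 : (mk x 1).1 = Γ 0 := by
        rw [hΓ, γ.source]
        simp [mk]
      have h1 : (mk y ((s b y)⁻¹ * s b x)).1 = Γ 1 := by
        rw [hΓ, γ.target]
        simp [mk, mul_assoc]
      apply cov.monodromy_eq_of_map_eq (⟦(⟨⟨Γ, hΓc⟩, h0.symm, h1.symm⟩ : Path _ _)⟧)
      rfl
    rw [hm, cd_mk]

end Holonomy
end GraphBraid
end

section
open unitInterval
namespace GraphBraid
open Topology CategoryTheory

/-- Data for a van Kampen style computation: a space covered by two open sets whose components
are contractible, and such that the components of the intersection are path connected. -/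
structure VK (Y : Type) [TopologicalSpace Y] (V Eg : Type) where
  O : Bool → Set Y
  isOpen : ∀ b, IsOpen (O b)
  cover : ∀ y, ∃ b, y ∈ O b
  pt : V → Y
  lab : Bool → Y → V
  lab_loc : ∀ b, ∀ y ∈ O b, ∀ᶠ z in 𝓝 y, lab b z = lab b y
  H : Bool → Y → I → Y
  H_cont : ∀ b, ContinuousOn (fun p : Y × I => H b p.1 p.2) (O b ×ˢ Set.univ)
  H_mem : ∀ b, ∀ y ∈ O b, ∀ t, H b y t ∈ O b
  H_zero : ∀ b, ∀ y ∈ O b, H b y 0 = y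
  H_one : ∀ b, ∀ y ∈ O b, H b y 1 = pt (lab b y)
  cl : V → Bool
  pt_mem : ∀ v, pt v ∈ O (cl v)
  pt_lab : ∀ v, lab (cl v) (pt v) = v
  pt_not : ∀ v, cl v = true → pt v ∉ O false
  H_pt : ∀ v t, H (cl v) (pt v) t = pt v
  src : Eg → V
  tgt : Eg → V
  cl_src : ∀ e, cl (src e) = true
  cl_tgt : ∀ e, cl (tgt e) = false
  ε : Y → Eg
  ε_loc : ∀ y, (∀ b, y ∈ O b) → ∀ᶠ z in 𝓝 y, ε z = ε y
  ε_src : ∀ y, (∀ b, y ∈ O b) → lab true y = src (ε y)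
  ε_tgt : ∀ y, (∀ b, y ∈ O b) → lab false y = tgt (ε y)
  ε_conn : ∀ y y', (∀ b, y ∈ O b) → (∀ b, y' ∈ O b) → ε y = ε y' →
    ∃ γ : Path y y', ∀ t b, γ t ∈ O b
  ε_surj : ∀ e, ∃ y, (∀ b, y ∈ O b) ∧ ε y = e

theorem square_homotopy {Y : Type} [TopologicalSpace Y] (F : C(I × I, Y)) {x y z : Y}
    (p : Path x y) (q : Path y z) (r : Path x z) (hp : ∀ s, p s = F (s, 0))
    (hq : ∀ t, q t = F (1, t)) (hr : ∀ t, r t = F (0, t)) (hz : ∀ s, F (s, 1) = z) :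
    (p.trans q).Homotopic r := by
  have hx : F (0, 0) = x := by rw [← hp, p.source]
  have hy : F (1, 0) = y := by rw [← hp, p.target]
  have hz1 : F (1, 1) = z := hz 1
  let id' : Path (0 : I) 1 := ⟨⟨id, continuous_id⟩, rfl, rfl⟩
  let p' : Path ((0, 0) : I × I) (1, 0) := id'.prod (Path.refl 0)
  let q' : Path ((1, 0) : I × I) (1, 1) := (Path.refl 1).prod id'
  let r' : Path ((0, 0) : I × I) (0, 1) := (Path.refl 0).prod id'
  let k' : Path ((0, 1) : I × I) (1, 1) := id'.prod (Path.refl 1)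
  have : ContractibleSpace I := (convex_Icc (0:ℝ) 1).contractibleSpace ⟨0, by simp⟩
  have key : (p'.trans q').Homotopic (r'.trans k') := SimplyConnectedSpace.paths_homotopic _ _
  have key2 := key.map F
  have e1 : p.trans q = (((p'.trans q').map F.continuous)).cast hx.symm hz1.symm := by
    ext t
    simp only [Path.trans_apply, Path.cast_coe, Path.map_coe, Function.comp]
    split_ifs
    · exact hp _
    · exact hq _
  have e2 : r.trans (Path.refl z) = ((r'.trans k').map F.continuous).cast hx.symm hz1.symm := by
    ext t
    simp only [Path.trans_apply, Path.cast_coe, Path.map_coe, Function.comp]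
    split_ifs
    · exact hr _
    · exact (hz _).symm
  have h1 : (p.trans q).Homotopic (r.trans (Path.refl z)) := by
    rw [e1, e2]
    subst hx hz1
    exact key2
  exact h1.trans ⟨Path.Homotopy.transRefl r⟩

namespace VK
variable {Y : Type} [TopologicalSpace Y] {V Eg : Type} (D : VK Y V Eg)

/-- the canonical path from a point of a chart to the centre of its component. -/
noncomputable def c (b : Bool) (y : Y) (v : V) (hy : y ∈ D.O b) (hv : D.lab b y = v) : Path y (D.pt v) where
  toFun := D.H b y
  continuous_toFun := by
    have h := (D.H_cont b).comp_continuous (f := fun t : I => (y, t)) (by fun_prop)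
      (fun t => ⟨hy, trivial⟩)
    exact h
  source' := D.H_zero b y hy
  target' := by rw [D.H_one b y hy, hv]

theorem c_mem (b : Bool) (y : Y) (v : V) (hy : y ∈ D.O b) (hv : D.lab b y = v) (t : I) :
    D.c b y v hy hv t ∈ D.O b := D.H_mem b y hy t

theorem lab_const {b : Bool} {y y' : Y} (γ : Path y y') (hγ : ∀ t, γ t ∈ D.O b) (t : I) :
    D.lab b (γ t) = D.lab b y := by
  have : IsLocallyConstant (fun t : I => D.lab b (γ t)) := by
    rw [IsLocallyConstant.iff_eventually_eq]
    intro t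
    exact (γ.continuous.continuousAt (x := t)).eventually (D.lab_loc b _ (hγ t))
  have h := this.apply_eq_of_preconnectedSpace t 0
  simpa using h

theorem c_nat {b : Bool} {y y' : Y} (γ : Path y y') (hγ : ∀ t, γ t ∈ D.O b) (v : V)
    (hy : y ∈ D.O b) (hv : D.lab b y = v) (hy' : y' ∈ D.O b) (hv' : D.lab b y' = v) :
    (γ.trans (D.c b y' v hy' hv')).Homotopic (D.c b y v hy hv) := by
  let F : C(I × I, Y) := ⟨fun p => D.H b (γ p.1) p.2, by
    exact (D.H_cont b).comp_continuous (f := fun p : I × I => (γ p.1, p.2)) (by fun_prop)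
      (fun t => ⟨hγ _, trivial⟩)⟩
  refine square_homotopy F _ _ _ ?_ ?_ ?_ ?_
  · intro s
    exact (D.H_zero b _ (hγ s)).symm
  · intro t
    simp [F, c]
  · intro t
    simp [F, c]
  · intro s
    simp only [F, ContinuousMap.coe_mk]
    rw [D.H_one b _ (hγ s), D.lab_const γ hγ, hv]

/-- objects of the fundamental groupoid -/
abbrev ob (y : Y) : FundamentalGroupoid Y := FundamentalGroupoid.mk y

/-- class of the canonical path -/
noncomputable def C (b : Bool) (y : Y) (v : V) (hy : y ∈ D.O b) (hv : D.lab b y = v) : ob y ⟶ ob (D.pt v) :=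
  Path.Homotopic.Quotient.mk (D.c b y v hy hv)

/-- class of a path -/
def cls {x y : Y} (γ : Path x y) : ob x ⟶ ob y := Path.Homotopic.Quotient.mk γ

theorem cls_trans {x y z : Y} (γ : Path x y) (δ : Path y z) : cls (γ.trans δ) = cls γ ≫ cls δ := rfl

theorem cls_symm {x y : Y} (γ : Path x y) : cls γ.symm = inv (cls γ) := by
  rw [← Groupoid.inv_eq_inv]; rfl

theorem C_nat {b : Bool} {y y' : Y} (γ : Path y y') (hγ : ∀ t, γ t ∈ D.O b) (v : V)
    (hy : y ∈ D.O b) (hv : D.lab b y = v) (hy' : y' ∈ D.O b) (hv' : D.lab b y' = v) :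
    cls γ ≫ D.C b y' v hy' hv' = D.C b y v hy hv :=
  Path.Homotopic.Quotient.eq.mpr (D.c_nat γ hγ v hy hv hy' hv')

theorem C_pt {b : Bool} {y : Y} (v : V) (hy : y ∈ D.O b) (hv : D.lab b y = v) (hb : D.cl v = b)
    (h : D.pt v = y) : D.C b y v hy hv = cls ((Path.refl y).cast rfl h) := by
  subst hb h
  have : D.c (D.cl v) (D.pt v) v hy hv = (Path.refl (D.pt v)).cast rfl rfl := by
    ext t
    exact D.H_pt v t
  unfold C cls
  rw [this]

theorem cls_comp_cast {x y z : Y} (γ : Path x y) (h : z = y) :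
    cls γ ≫ cls ((Path.refl y).cast rfl h) = cls (γ.cast rfl h) := by
  subst h
  exact Category.comp_id (cls γ)

/-- The groupoid on the chosen base points. -/
abbrev Gp : Type := InducedCategory (FundamentalGroupoid Y) (fun v : V => ob (D.pt v))

/-- chosen point in each edge component -/
noncomputable def ye (e : Eg) : Y := (D.ε_surj e).choose
theorem ye_mem (e : Eg) : ∀ b, D.ye e ∈ D.O b := (D.ε_surj e).choose_spec.1
theorem ye_ε (e : Eg) : D.ε (D.ye e) = e := (D.ε_surj e).choose_spec.2

/-- the morphism of an edge. -/
noncomputable def edge (e : Eg) (v w : V) (hv : D.src e = v) (hw : D.tgt e = w) :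
    ob (D.pt v) ⟶ ob (D.pt w) :=
  inv (D.C true (D.ye e) v (D.ye_mem e _) (by rw [D.ε_src _ (D.ye_mem e), D.ye_ε, hv])) ≫
    D.C false (D.ye e) w (D.ye_mem e _) (by rw [D.ε_tgt _ (D.ye_mem e), D.ye_ε, hw])

theorem edge_eq (y : Y) (hy : ∀ b, y ∈ D.O b) (v w : V) (hv : D.lab true y = v)
    (hw : D.lab false y = w) :
    D.C true y v (hy _) hv ≫ D.edge (D.ε y) v w (by rw [← D.ε_src _ hy, hv])
      (by rw [← D.ε_tgt _ hy, hw]) = D.C false y w (hy _) hw := by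
  obtain ⟨γ, hγ⟩ := D.ε_conn y (D.ye (D.ε y)) hy (D.ye_mem _) (D.ye_ε _).symm
  rw [edge, ← D.C_nat γ (fun t => hγ t true) v (hy _) hv (D.ye_mem _ _)
    (by rw [D.ε_src _ (D.ye_mem _), D.ye_ε, ← hv, D.ε_src _ hy]),
    ← D.C_nat γ (fun t => hγ t false) w (hy _) hw (D.ye_mem _ _)
    (by rw [D.ε_tgt _ (D.ye_mem _), D.ye_ε, ← hw, D.ε_tgt _ hy])]
  simp

theorem exists_functor {X : Type} [Group X] (f : Eg → X) :
    ∃ F : D.Gp ⥤ SingleObj X, ∀ e v w hv hw,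
      F.map (InducedCategory.homMk (D.edge e v w hv hw) : (show D.Gp from v) ⟶ w) = f e := by
  classical
  obtain ⟨Hol, h1, h2, h3⟩ := exists_holonomy D.O D.isOpen D.cover
    (fun b y => if b = true ∧ (∀ b, y ∈ D.O b) then (f (D.ε y))⁻¹ else 1) (by
      intro y hy b
      have hO : ∀ᶠ z in 𝓝 y, ∀ b, z ∈ D.O b := by
        rw [Filter.eventually_all]
        intro b
        exact (D.isOpen b).mem_nhds (hy b)
      filter_upwards [hO, D.ε_loc y hy] with z hz hz2
      simp only [hz, hy, hz2])
  refine ⟨{ obj := fun _ => SingleObj.star X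
            map := fun p => Hol _ _ p.hom
            map_id := fun v => h1 _
            map_comp := fun p q => h2 _ _ _ _ _ }, ?_⟩
  intro e v w hv hw
  change Hol _ _ (D.edge e v w hv hw) = f e
  unfold edge
  have hvl : D.lab true (D.ye e) = v := by rw [D.ε_src _ (D.ye_mem e), D.ye_ε, hv]
  have hwl : D.lab false (D.ye e) = w := by rw [D.ε_tgt _ (D.ye_mem e), D.ye_ε, hw]
  have i1 : inv (D.C true (D.ye e) v (D.ye_mem e _) hvl) =
      cls (D.c true (D.ye e) v (D.ye_mem e _) hvl).symm := (cls_symm _).symm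
  rw [i1]
  have k1 := h3 true _ _ (D.c true (D.ye e) v (D.ye_mem e _) hvl).symm
    (fun t => D.c_mem true (D.ye e) v (D.ye_mem e _) hvl (σ t))
  have k2 := h3 false _ _ (D.c false (D.ye e) w (D.ye_mem e _) hwl)
    (fun t => D.c_mem false (D.ye e) w (D.ye_mem e _) hwl t)
  have hpv : ¬ (∀ b, D.pt v ∈ D.O b) := by
    intro h
    exact D.pt_not v (by rw [← hv, D.cl_src]) (h false)
  refine (h2 _ _ _ _ _).trans ?_
  refine (congrArg₂ (· * ·) k2 k1).trans ?_
  simp only [D.ye_mem, D.ye_ε, hpv]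
  simp

theorem homotopic_cast_left {x x' y z : Y} (h : x' = x) {p : Path x y} {q : Path y z} {r : Path x z}
    (k : (p.trans q).Homotopic r) : ((p.cast h rfl).trans q).Homotopic (r.cast h rfl) := by
  subst h
  exact k

theorem functor_unique {X : Type} [Group X] (F F' : D.Gp ⥤ SingleObj X)
    (h : ∀ e v w hv hw, F.map (InducedCategory.homMk (D.edge e v w hv hw) : (show D.Gp from v) ⟶ w) =
      F'.map (InducedCategory.homMk (D.edge e v w hv hw) : (show D.Gp from v) ⟶ w)) : F = F' := by
  let A : ∀ v w : V, (ob (D.pt v) ⟶ ob (D.pt w)) → Prop := fun v w p =>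
    (F.map (InducedCategory.homMk p : (show D.Gp from v) ⟶ w) : X) =
      (F'.map (InducedCategory.homMk p : (show D.Gp from v) ⟶ w) : X)
  have Acomp : ∀ u v w p q, A u v p → A v w q → A u w (p ≫ q) := by
    intro u v w p q hp hq
    have e : (InducedCategory.homMk (p ≫ q) : (show D.Gp from u) ⟶ w) =
      (InducedCategory.homMk p : (show D.Gp from u) ⟶ v) ≫ (InducedCategory.homMk q : (show D.Gp from v) ⟶ w) := rfl
    change F.map _ = F'.map _
    rw [e, F.map_comp, F'.map_comp]
    exact congrArg₂ (fun a b : X => b * a) hp hq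
  have Ainv : ∀ u v p, A u v p → A v u (inv p) := by
    intro u v p hp
    have e : (InducedCategory.homMk (inv p) : (show D.Gp from v) ⟶ u) =
        inv (InducedCategory.homMk p : (show D.Gp from u) ⟶ v) := by
      rw [← cancel_mono (InducedCategory.homMk p : (show D.Gp from u) ⟶ v)]
      apply InducedCategory.hom_ext
      simp
    change F.map _ = F'.map _
    rw [e, F.map_inv, F'.map_inv, SingleObj.inv_as_inv, SingleObj.inv_as_inv]
    exact congrArg (fun a : X => a⁻¹) hp
  have Aid : ∀ u, A u u (𝟙 _) := by
    intro u
    change F.map (𝟙 (show D.Gp from u)) = F'.map (𝟙 (show D.Gp from u))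
    rw [F.map_id, F'.map_id]
    rfl
  have main : ∀ v w (γ : Path (D.pt v) (D.pt w)), A v w (cls γ) := by
    intro v w γ
    let q : ∀ t : I, ob (D.pt v) ⟶ ob (γ t) := fun t => cls ((γ.subpath 0 t).cast γ.source.symm rfl)
    have hq : ∀ t t', q t ≫ cls (γ.subpath t t') = q t' := by
      intro t t'
      have := (⟨Path.Homotopy.subpathTransSubpath γ 0 t t'⟩ : Path.Homotopic _ _)
      have h2 : (((γ.subpath 0 t).cast γ.source.symm rfl).trans (γ.subpath t t')).Homotopic
        ((γ.subpath 0 t').cast γ.source.symm rfl) := by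
          exact homotopic_cast_left _ this
      exact Path.Homotopic.Quotient.eq.mpr h2
    let P : I → Prop := fun t => ∀ b u (hb : γ t ∈ D.O b) (hu : D.lab b (γ t) = u),
      A v u (q t ≫ D.C b (γ t) u hb hu)
    have one : ∀ t b u (hb : γ t ∈ D.O b) (hu : D.lab b (γ t) = u),
        A v u (q t ≫ D.C b (γ t) u hb hu) → P t := by
      intro t b u hb hu hA b' u' hb' hu'
      rcases b with _ | _ <;> rcases b' with _ | _
      · subst hu hu'; exact hA
      · have hy : ∀ b, γ t ∈ D.O b := by rintro (_ | _) <;> assumption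
        have he := D.edge_eq (γ t) hy u' u hu' hu
        rw [← he] at hA
        have h2 := Acomp _ _ _ _ _ hA (Ainv _ _ _ (h (D.ε (γ t)) u' u (by rw [← D.ε_src _ hy, hu'])
          (by rw [← D.ε_tgt _ hy, hu])))
        simpa using h2
      · have hy : ∀ b, γ t ∈ D.O b := by rintro (_ | _) <;> assumption
        have he := D.edge_eq (γ t) hy u u' hu hu'
        rw [← he, ← Category.assoc]
        exact Acomp _ _ _ _ _ hA (h _ _ _ _ _)
      · subst hu hu'; exact hA
    have trans : ∀ t t' b, (∀ s, γ.subpath t t' s ∈ D.O b) → P t → P t' := by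
      intro t t' b hs hP
      have ht : γ t ∈ D.O b := by simpa using hs 0
      have ht' : γ t' ∈ D.O b := by simpa using hs 1
      have hl := D.lab_const (γ.subpath t t') hs 1
      rw [Path.target] at hl
      refine one t' b _ ht' hl ?_
      have := hP b _ ht rfl
      rw [← D.C_nat (γ.subpath t t') hs _ ht rfl ht' hl, ← Category.assoc, hq] at this
      exact this
    have hloc : IsLocallyConstant P := by
      rw [IsLocallyConstant.iff_eventually_eq]
      intro t
      obtain ⟨b, hb⟩ := D.cover (γ t)
      have hop : IsOpen (γ ⁻¹' D.O b) := (D.isOpen b).preimage γ.continuous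
      have hmem : γ ⁻¹' D.O b ∈ 𝓝 t := hop.mem_nhds hb
      obtain ⟨ε, hε, hball⟩ := Metric.mem_nhds_iff.mp hmem
      · have hsub : ∀ t' ∈ Metric.ball t ε, ∀ s, γ.subpath t t' s ∈ D.O b := by
          intro t' ht' s
          have : γ.subpath t t' s ∈ Set.range (γ.subpath t t') := ⟨s, rfl⟩
          rw [Path.range_subpath] at this
          obtain ⟨r, hr, hr2⟩ := this
          rw [← hr2]
          apply hball
          rw [Metric.mem_ball, Subtype.dist_eq, Real.dist_eq] at *
          have hr' : (r : ℝ) ∈ Set.uIcc (t : ℝ) t' := by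
            rcases le_total t t' with hle | hle
            · rw [Set.uIcc_of_le hle] at hr
              rw [Set.uIcc_of_le (by exact_mod_cast hle)]; exact hr
            · rw [Set.uIcc_of_ge hle] at hr
              rw [Set.uIcc_of_ge (by exact_mod_cast hle)]; exact hr
          exact lt_of_le_of_lt (Set.abs_sub_left_of_mem_uIcc hr') ht'
        filter_upwards [Metric.ball_mem_nhds t hε] with t' ht'
        apply propext
        constructor
        · refine trans t' t b ?_
          intro s
          rw [← Path.symm_subpath]
          exact hsub t' ht' _
        · exact trans t t' b (hsub t' ht')
    have P0 : P 0 := by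
      have h0 : γ 0 = D.pt v := γ.source
      refine one 0 (D.cl v) v (by rw [h0]; exact D.pt_mem v) (by rw [h0]; exact D.pt_lab v) ?_
      rw [D.C_pt v _ _ rfl h0.symm]
      have : q 0 ≫ cls ((Path.refl (γ 0)).cast rfl h0.symm) = 𝟙 _ := by
        simp only [q]
        rw [cls_comp_cast, Path.subpath_self]
        have : (((Path.refl (γ 0)).cast γ.source.symm rfl).cast rfl h0.symm) = Path.refl (D.pt v) := by
          ext; simp
        rw [this]
        rfl
      rw [this]
      exact Aid v
    have P1 : P 1 := by rw [hloc.apply_eq_of_preconnectedSpace 1 0]; exact P0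
    have h1 : γ 1 = D.pt w := γ.target
    have := P1 (D.cl w) w (by rw [h1]; exact D.pt_mem w) (by rw [h1]; exact D.pt_lab w)
    rw [D.C_pt w _ _ rfl h1.symm] at this
    have h2 : q 1 ≫ cls ((Path.refl (γ 1)).cast rfl h1.symm) = cls γ := by
      simp only [q]
      rw [cls_comp_cast, Path.subpath_zero_one]
      congr 1
    rw [h2] at this
    exact this
  refine Functor.hext (fun _ => rfl) ?_
  intro v w p
  apply heq_of_eq
  obtain ⟨p⟩ := p
  obtain ⟨γ⟩ := p
  exact main v w γ

noncomputable instance isFree : IsFreeGroupoid D.Gp where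
  quiverGenerators := ⟨fun v w => {e : Eg // D.src e = v ∧ D.tgt e = w}⟩
  of := fun e => InducedCategory.homMk (D.edge e.1 _ _ e.2.1 e.2.2)
  unique_lift := by
    intro X _ f
    obtain ⟨F, hF⟩ := D.exists_functor (fun e : Eg => @f (D.src e) (D.tgt e) ⟨e, rfl, rfl⟩)
    refine ⟨F, ?_, ?_⟩
    · rintro v w ⟨e, rfl, rfl⟩
      exact hF e _ _ rfl rfl
    · intro F' hF'
      apply D.functor_unique
      intro e v w hv hw
      rw [hF]
      subst hv hw
      exact hF' (D.src e) (D.tgt e) ⟨e, rfl, rfl⟩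

end VK
end GraphBraid
end

section
open unitInterval
namespace GraphBraid
open Topology CategoryTheory

theorem functor_count {G : Type} [Groupoid.{0} G] (r : G) (τ : ∀ v, r ⟶ v) (hτ : τ r = 𝟙 r)
    (X : Type) [CommGroup X] :
    Nonempty ((G ⥤ SingleObj X) ≃ (End r →* X) × ({v : G // v ≠ r} → X)) := by
  classical
  let res : (G ⥤ SingleObj X) → (End r →* X) := fun F =>
    { toFun := fun p => F.map p
      map_one' := F.map_id r
      map_mul' := fun p q => F.map_comp q p }
  let ex : ({v : G // v ≠ r} → X) → G → X := fun c v => if h : v = r then 1 else c ⟨v, h⟩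
  let loop : ∀ {a b : G}, (a ⟶ b) → End r := fun {a b} p => τ a ≫ p ≫ inv (τ b)
  have hloop_id : ∀ a, loop (𝟙 a) = 1 := by
    intro a; simp [loop]
  have hloop_comp : ∀ {a b c : G} (p : a ⟶ b) (q : b ⟶ c), loop (p ≫ q) = loop q * loop p := by
    intro a b c p q
    change _ = loop p ≫ loop q
    simp [loop]
  refine ⟨{ toFun := fun F => (res F, fun v => F.map (τ v.1))
            invFun := fun φ =>
              { obj := fun _ => SingleObj.star X
                map := fun {a b} p => (ex φ.2 b * φ.1 (loop p) * (ex φ.2 a)⁻¹ : X)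
                map_id := ?_
                map_comp := ?_ }
            left_inv := ?_
            right_inv := ?_ }⟩
  · intro a
    rw [hloop_id, map_one]
    simp
    rfl
  · intro a b c p q
    rw [hloop_comp, map_mul]
    change _ = (ex φ.2 c * φ.1 (loop q) * (ex φ.2 b)⁻¹ : X) * (ex φ.2 b * φ.1 (loop p) * (ex φ.2 a)⁻¹ : X)
    generalize ex φ.2 c = C
    generalize ex φ.2 b = B
    generalize ex φ.2 a = A
    group
  · intro F
    refine Functor.hext (fun _ => rfl) ?_
    intro a b p
    apply heq_of_eq
    have hex : ∀ v, ex (fun v => F.map (τ v.1)) v = (F.map (τ v) : X) := by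
      intro v
      by_cases h : v = r
      · subst h
        simp only [ex, dif_pos, hτ, F.map_id]
        rfl
      · simp only [ex, dif_neg h]
    change (ex (fun v => F.map (τ v.1)) b * F.map (loop p) * (ex (fun v => F.map (τ v.1)) a)⁻¹ : X) = F.map p
    rw [hex, hex]
    have h1 : loop p ≫ τ b = τ a ≫ p := by simp [loop]
    have h2 : (F.map (τ b) * F.map (loop p) : X) = (F.map p * F.map (τ a) : X) := by
      have := congrArg (fun q => (F.map q : X)) h1
      simp only [F.map_comp] at this
      exact this
    rw [h2, mul_inv_cancel_right]
  · rintro ⟨φ, c⟩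
    have hr : ex c r = 1 := by simp [ex]
    refine Prod.ext (MonoidHom.ext fun p => ?_) (funext fun v => ?_)
    · change (ex c r * φ (loop p) * (ex c r)⁻¹ : X) = φ p
      rw [hr]
      have : loop p = p := by simp [loop, hτ]
      rw [this]
      simp
    · change (ex c v.1 * φ (loop (τ v.1)) * (ex c r)⁻¹ : X) = c v
      rw [hr]
      have : loop (τ v.1) = 1 := by simp [loop, hτ]
      rw [this, map_one]
      simp [ex, v.2]

namespace VK
variable {Y : Type} [TopologicalSpace Y] {V Eg : Type} (D : VK Y V Eg)

theorem functor_edges (X : Type) [CommGroup X] : Nonempty ((D.Gp ⥤ SingleObj X) ≃ (Eg → X)) := by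
  refine ⟨Equiv.ofBijective (fun F e => F.map (InducedCategory.homMk (D.edge e (D.src e) (D.tgt e) rfl rfl) :
    (show D.Gp from D.src e) ⟶ D.tgt e)) ⟨?_, ?_⟩⟩
  · intro F F' h
    apply D.functor_unique
    rintro e v w rfl rfl
    exact congrFun h e
  · intro f
    obtain ⟨F, hF⟩ := D.exists_functor f
    exact ⟨F, funext fun e => hF e _ _ rfl rfl⟩

theorem free_pt [Finite V] [Finite Eg] (hconn : ∀ v w, Joined (D.pt v) (D.pt w)) (r : V) (k : ℕ)
    (hk : k + Nat.card V = Nat.card Eg + 1) :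
    Nonempty (FundamentalGroup Y (D.pt r) ≃* FreeGroup (Fin k)) := by
  classical
  have hc : ∀ v w : D.Gp, Nonempty (v ⟶ w) := fun v w => ⟨InducedCategory.homMk (cls (hconn v w).some)⟩
  have : Nonempty D.Gp := ⟨r⟩
  have : IsConnected D.Gp := zigzag_isConnected fun v w => Zigzag.of_hom (hc v w).some
  have : IsFreeGroup (End (show D.Gp from r)) := IsFreeGroupoid.endIsFreeOfConnectedFree (G := D.Gp) r
  let ι := IsFreeGroup.Generators (End (show D.Gp from r))
  let e0 : End (show D.Gp from r) ≃* FreeGroup ι := IsFreeGroup.toFreeGroup _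
  let X := Multiplicative (ZMod 2)
  let τ : ∀ v : D.Gp, (show D.Gp from r) ⟶ v := fun v => if h : (show D.Gp from r) = v then eqToHom h else (hc r v).some
  obtain ⟨e1⟩ := functor_count (G := D.Gp) r τ (by simp [τ]) X
  obtain ⟨e2⟩ := D.functor_edges X
  let e3 : (ι → X) ≃ (End (show D.Gp from r) →* X) := IsFreeGroup.lift
  let e4 : (Eg → X) ≃ (ι → X) × ({v : V // v ≠ r} → X) := e2.symm.trans (e1.trans (Equiv.prodCongr e3.symm (Equiv.refl _)))
  have : Finite X := inferInstanceAs (Finite (ZMod 2))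
  have : Finite ((ι → X) × ({v : V // v ≠ r} → X)) := Finite.of_equiv _ e4
  have : Finite (ι → X) := Finite.of_surjective (fun p : (ι → X) × ({v : V // v ≠ r} → X) => p.1)
    (fun a => ⟨(a, 1), rfl⟩)
  have : Nontrivial X := inferInstanceAs (Nontrivial (ZMod 2))
  have hX : Nat.card X = 2 := by
    change Nat.card (ZMod 2) = 2
    simp
  have : Finite ι := by
    obtain ⟨x, hx⟩ := exists_ne (1 : X)
    refine Finite.of_injective (fun i : ι => (Pi.mulSingle i x : ι → X)) ?_
    intro i j hij
    by_contra hne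
    have := congrFun hij i
    simp [Pi.mulSingle_eq_of_ne hne, hx] at this
  have hcard := Nat.card_congr e4
  rw [Nat.card_prod, Nat.card_fun, Nat.card_fun, Nat.card_fun, hX, ← pow_add] at hcard
  have hcard2 := Nat.pow_right_injective (le_refl 2) hcard
  have hV : Nat.card {v : V // v ≠ r} + 1 = Nat.card V := by
    have := Fintype.ofFinite V
    rw [Nat.card_eq_fintype_card, Nat.card_eq_fintype_card, Fintype.card_subtype_compl]
    have : 0 < Fintype.card V := Fintype.card_pos_iff.mpr ⟨r⟩
    simp
    omega
  have hι : Nat.card ι = k := by omega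
  let e5 : ι ≃ Fin k := (Finite.equivFin ι).trans (finCongr hι)
  let e6 : End (show D.Gp from r) ≃* FundamentalGroup Y (D.pt r) :=
    { toFun := fun p => p.hom
      invFun := fun p => InducedCategory.homMk p
      left_inv := fun p => rfl
      right_inv := fun p => rfl
      map_mul' := fun p q => rfl }
  exact ⟨(e6.symm.trans e0).trans (FreeGroup.freeGroupCongr e5)⟩

theorem free [Finite V] [Finite Eg] (hconn : ∀ v w, Joined (D.pt v) (D.pt w)) (y : Y) (k : ℕ)
    (hk : k + Nat.card V = Nat.card Eg + 1) :
    Nonempty (FundamentalGroup Y y ≃* FreeGroup (Fin k)) := by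
  obtain ⟨b, hb⟩ := D.cover y
  obtain ⟨e⟩ := D.free_pt hconn (D.lab b y) k hk
  exact ⟨(FundamentalGroup.fundamentalGroupMulEquivOfPath (D.c b y _ hb rfl)).trans e⟩

end VK
end GraphBraid
end

section
open unitInterval
namespace GraphBraid
open Topology CategoryTheory

set_option linter.unusedSectionVars false
set_option linter.style.haveILetI false
section Comb
open Classical
variable {n : ℕ} {N : Type} [Fintype N]

/-- the special (strictly closest) point, used in the mode `b = true` only -/
def Sp (b : Bool) (r : Fin n → ℝ) (a : Fin n) : Prop := b = true ∧ ∀ c, c ≠ a → r a < r c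

/-- admissibility of a tuple of radii for the chart `b` -/
def Ob (b : Bool) (r : Fin n → ℝ) : Prop :=
  (b = false ∧ ∀ a, 0 < r a) ∨ (b = true ∧ ∃ a, Sp true r a)

/-- rank along the leg -/
noncomputable def rk (b : Bool) (l : Fin n → N) (r : Fin n → ℝ) (a : Fin n) : ℕ :=
  (Finset.univ.filter (fun c => ¬ Sp b r c ∧ l c = l a ∧ r c < r a)).card

/-- target radius -/
noncomputable def tg (b : Bool) (s : ℝ) (l : Fin n → N) (r : Fin n → ℝ) (a : Fin n) : ℝ :=
  if Sp b r a then s else ((rk b l r a : ℝ) + 1) / (n + 1)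

/-- number of non special points on a leg -/
noncomputable def kk (b : Bool) (l : Fin n → N) (r : Fin n → ℝ) (i : N) : ℕ :=
  (Finset.univ.filter (fun c => ¬ Sp b r c ∧ l c = i)).card

theorem Sp_unique {b b' : Bool} {r : Fin n → ℝ} {a c : Fin n} (h : Sp b r a) (h' : Sp b' r c) : a = c := by
  by_contra hne
  exact lt_asymm (h.2 c (Ne.symm hne)) (h'.2 a hne)

theorem nonSp_pos {b : Bool} {r : Fin n → ℝ} (h0 : ∀ a, 0 ≤ r a) (h : Ob b r) {a : Fin n}
    (ha : ¬ Sp b r a) : 0 < r a := by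
  rcases h with ⟨_, h⟩ | ⟨rfl, a0, h⟩
  · exact h a
  · have : a ≠ a0 := by rintro rfl; exact ha h
    exact lt_of_le_of_lt (h0 a0) (h.2 a this)

theorem not_Sp_of_lt {b : Bool} {r : Fin n → ℝ} {a c : Fin n} (h : r a < r c) : ¬ Sp b r c := by
  rintro ⟨_, h2⟩
  have : a ≠ c := by rintro rfl; exact lt_irrefl _ h
  exact lt_asymm h (h2 a this)

theorem rk_lt (b : Bool) (l : Fin n → N) (r : Fin n → ℝ) (a : Fin n) : rk b l r a < n := by
  have : rk b l r a < (Finset.univ : Finset (Fin n)).card := by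
    apply Finset.card_lt_card
    rw [Finset.ssubset_univ_iff]
    intro h
    have : a ∈ Finset.univ.filter (fun c => ¬ Sp b r c ∧ l c = l a ∧ r c < r a) := by rw [h]; simp
    simp at this
  simpa using this

theorem rk_mono {b : Bool} {l : Fin n → N} {r : Fin n → ℝ} {a c : Fin n} (ha : ¬ Sp b r a) (hl : l a = l c)
    (hr : r a < r c) : rk b l r a < rk b l r c := by
  apply Finset.card_lt_card
  rw [Finset.ssubset_iff_of_subset]
  · refine ⟨a, ?_, ?_⟩
    · simp [ha, hl, hr]
    · simp
  · intro d
    simp only [Finset.mem_filter, Finset.mem_univ, true_and]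
    rintro ⟨h1, h2, h3⟩
    exact ⟨h1, h2.trans hl, h3.trans hr⟩

theorem tg_nonSp_ge {b : Bool} {s : ℝ} {l : Fin n → N} {r : Fin n → ℝ} {a : Fin n} (ha : ¬ Sp b r a) :
    1 / ((n : ℝ) + 1) ≤ tg b s l r a := by
  rw [tg, if_neg ha]
  gcongr
  simp

theorem tg_nonSp_pos {b : Bool} {s : ℝ} {l : Fin n → N} {r : Fin n → ℝ} {a : Fin n} (ha : ¬ Sp b r a) :
    0 < tg b s l r a := lt_of_lt_of_le (by positivity) (tg_nonSp_ge ha)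

theorem tg_mem {b : Bool} {s : ℝ} (hs : 0 ≤ s) (hs1 : s < 1 / ((n : ℝ) + 1)) (l : Fin n → N) (r : Fin n → ℝ)
    (a : Fin n) : 0 ≤ tg b s l r a ∧ tg b s l r a ≤ 1 := by
  by_cases ha : Sp b r a
  · rw [tg, if_pos ha]
    refine ⟨hs, hs1.le.trans ?_⟩
    rw [div_le_one (by positivity)]
    linarith [(Nat.cast_nonneg n : (0 : ℝ) ≤ n)]
  · refine ⟨(tg_nonSp_pos ha).le, ?_⟩
    rw [tg, if_neg ha, div_le_one (by positivity)]
    have : (rk b l r a : ℝ) ≤ n := by exact_mod_cast (rk_lt b l r a).le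
    linarith

theorem tg_mono {b : Bool} {s : ℝ} (hs1 : s < 1 / ((n : ℝ) + 1)) {l : Fin n → N} {r : Fin n → ℝ}
    {a c : Fin n} (hl : l a = l c) (hr : r a < r c) : tg b s l r a < tg b s l r c := by
  have hc : ¬ Sp b r c := not_Sp_of_lt hr
  by_cases ha : Sp b r a
  · have : tg b s l r a = s := if_pos ha
    rw [this]
    exact hs1.trans_le (tg_nonSp_ge hc)
  · rw [tg, if_neg ha, tg, if_neg hc]
    have : (rk b l r a : ℝ) < rk b l r c := by exact_mod_cast rk_mono ha hl hr
    gcongr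

/-- interpolated radius -/
noncomputable def xx (b : Bool) (s : ℝ) (l : Fin n → N) (r : Fin n → ℝ) (t : ℝ) (a : Fin n) : ℝ :=
  (1 - t) * r a + t * tg b s l r a

theorem comb_lt {t x y x' y' : ℝ} (h0 : 0 ≤ t) (h1 : t ≤ 1) (h : x < y) (h' : x' < y') :
    (1 - t) * x + t * x' < (1 - t) * y + t * y' := by
  rcases h0.eq_or_lt with rfl | h0
  · simpa using h
  · have a1 : t * x' < t * y' := by gcongr
    have a2 : (1 - t) * x ≤ (1 - t) * y := mul_le_mul_of_nonneg_left h.le (by linarith)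
    linarith

theorem xx_mono {b : Bool} {s : ℝ} (hs1 : s < 1 / ((n : ℝ) + 1)) {l : Fin n → N} {r : Fin n → ℝ}
    {t : ℝ} (h0 : 0 ≤ t) (h1 : t ≤ 1)
    {a c : Fin n} (hl : l a = l c) (hr : r a < r c) : xx b s l r t a < xx b s l r t c :=
  comb_lt h0 h1 hr (tg_mono hs1 hl hr)

theorem xx_pos {b : Bool} {s : ℝ} {l : Fin n → N} {r : Fin n → ℝ}
    {t : ℝ} (h0 : 0 ≤ t) (h1 : t ≤ 1) (hr0 : ∀ a, 0 ≤ r a) (hO : Ob b r)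
    {a : Fin n} (ha : ¬ Sp b r a) : 0 < xx b s l r t a := by
  have := comb_lt h0 h1 (nonSp_pos hr0 hO ha) (tg_nonSp_pos (s := s) (l := l) ha)
  simpa [xx] using this

theorem xx_mem {b : Bool} {s : ℝ} (hs : 0 ≤ s) (hs1 : s < 1 / ((n : ℝ) + 1)) {l : Fin n → N} {r : Fin n → ℝ}
    {t : ℝ} (h0 : 0 ≤ t) (h1 : t ≤ 1) (hr0 : ∀ a, 0 ≤ r a ∧ r a ≤ 1) (a : Fin n) :
    0 ≤ xx b s l r t a ∧ xx b s l r t a ≤ 1 := by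
  obtain ⟨p, q⟩ := tg_mem (b := b) hs hs1 l r a
  obtain ⟨p', q'⟩ := hr0 a
  have := convex_Icc (0 : ℝ) 1 (⟨p', q'⟩ : r a ∈ Set.Icc (0:ℝ) 1) (⟨p, q⟩ : tg b s l r a ∈ Set.Icc (0:ℝ) 1)
    (a := 1 - t) (b := t) (by linarith) h0 (by ring)
  exact this

theorem xx_Sp {b : Bool} {s : ℝ} (hs1 : s < 1 / ((n : ℝ) + 1)) {l : Fin n → N} {r : Fin n → ℝ}
    {t : ℝ} (h0 : 0 ≤ t) (h1 : t ≤ 1) {a : Fin n} (ha : Sp b r a) : Sp b (xx b s l r t) a := by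
  refine ⟨ha.1, fun c hc => ?_⟩
  have hr := ha.2 c hc
  refine comb_lt h0 h1 hr ?_
  have hc : ¬ Sp b r c := not_Sp_of_lt hr
  have : tg b s l r a = s := if_pos ha
  rw [this]
  exact hs1.trans_le (tg_nonSp_ge hc)

theorem xx_Ob {b : Bool} {s : ℝ} (hs1 : s < 1 / ((n : ℝ) + 1)) {l : Fin n → N} {r : Fin n → ℝ}
    {t : ℝ} (h0 : 0 ≤ t) (h1 : t ≤ 1) (hr0 : ∀ a, 0 ≤ r a) (hO : Ob b r) : Ob b (xx b s l r t) := by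
  have hO' := hO
  rcases hO with ⟨rfl, h⟩ | ⟨rfl, a0, h⟩
  · left
    exact ⟨rfl, fun a => xx_pos h0 h1 hr0 hO' (fun h => by simp [Sp] at h)⟩
  · right
    exact ⟨rfl, a0, xx_Sp hs1 h0 h1 h⟩

theorem xx_Sp_iff {b : Bool} {s : ℝ} (hs1 : s < 1 / ((n : ℝ) + 1)) {l : Fin n → N} {r : Fin n → ℝ}
    {t : ℝ} (h0 : 0 ≤ t) (h1 : t ≤ 1) (hO : Ob b r) {a : Fin n} :
    Sp b r a ↔ Sp b (xx b s l r t) a := by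
  refine ⟨xx_Sp hs1 h0 h1, fun h => ?_⟩
  rcases hO with ⟨rfl, _⟩ | ⟨rfl, a0, h'⟩
  · simp [Sp] at h
  · rwa [Sp_unique h (xx_Sp hs1 h0 h1 h')]

def SameType (b : Bool) (l l' : Fin n → N) (r r' : Fin n → ℝ) : Prop :=
  (∀ a, Sp b r a ↔ Sp b r' a) ∧ (∀ a, ¬ Sp b r a → l a = l' a) ∧
    ∀ a c, ¬ Sp b r a → ¬ Sp b r c → l a = l c → (r a < r c ↔ r' a < r' c)

theorem SameType.rk {b : Bool} {l l' : Fin n → N} {r r' : Fin n → ℝ} (h : SameType b l l' r r') {a : Fin n}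
    (ha : ¬ Sp b r a) : rk b l r a = rk b l' r' a := by
  unfold GraphBraid.rk
  congr 1
  ext c
  simp only [Finset.mem_filter, Finset.mem_univ, true_and]
  rw [← h.1 c]
  refine and_congr_right fun hc => ?_
  rw [← h.2.1 c hc, ← h.2.1 a ha]
  refine and_congr_right fun hl => ?_
  exact h.2.2 c a hc ha hl

theorem SameType.tg {b : Bool} {s : ℝ} {l l' : Fin n → N} {r r' : Fin n → ℝ} (h : SameType b l l' r r')
    (a : Fin n) : tg b s l r a = tg b s l' r' a := by
  unfold GraphBraid.tg
  by_cases ha : Sp b r a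
  · rw [if_pos ha, if_pos ((h.1 a).mp ha)]
  · rw [if_neg ha, if_neg (fun h' => ha ((h.1 a).mpr h')), h.rk ha]

theorem SameType.kk {b : Bool} {l l' : Fin n → N} {r r' : Fin n → ℝ} (h : SameType b l l' r r') :
    kk b l r = kk b l' r' := by
  funext i
  unfold GraphBraid.kk
  congr 1
  ext c
  simp only [Finset.mem_filter, Finset.mem_univ, true_and]
  rw [← h.1 c]
  refine and_congr_right fun hc => ?_
  rw [← h.2.1 c hc]

theorem rk_range {b : Bool} {l : Fin n → N} {r : Fin n → ℝ} (hinj : ∀ a c, l a = l c → r a = r c → a = c)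
    (i : N) (j : ℕ) : (∃ a, ¬ Sp b r a ∧ l a = i ∧ rk b l r a = j) ↔ j < kk b l r i := by
  let A := Finset.univ.filter (fun c => ¬ Sp b r c ∧ l c = i)
  have h1 : A.image (rk b l r) ⊆ Finset.range (kk b l r i) := by
    intro j hj
    simp only [A, Finset.mem_image, Finset.mem_filter, Finset.mem_univ, true_and] at hj
    obtain ⟨a, ⟨ha, hl⟩, rfl⟩ := hj
    rw [Finset.mem_range]
    apply Finset.card_lt_card
    rw [Finset.ssubset_iff_of_subset]
    · refine ⟨a, ?_, ?_⟩
      · simp [ha, hl]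
      · simp
    · intro d
      simp only [Finset.mem_filter, Finset.mem_univ, true_and]
      rintro ⟨h1, h2, h3⟩
      exact ⟨h1, h2.trans hl⟩
  have h2 : A.image (rk b l r) = Finset.range (kk b l r i) := by
    apply Finset.eq_of_subset_of_card_le h1
    rw [Finset.card_image_of_injOn]
    · simp [kk, A]
    · intro a ha c hc hac
      simp only [A, Finset.coe_filter, Finset.mem_univ, true_and, Set.mem_ofPred_eq] at ha hc
      have hl : l a = l c := ha.2.trans hc.2.symm
      apply hinj a c hl
      rcases lt_trichotomy (r a) (r c) with h | h | h
      · exact absurd hac (rk_mono ha.1 hl h).ne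
      · exact h
      · exact absurd hac (rk_mono hc.1 hl.symm h).ne'
  rw [← Finset.mem_range, ← h2]
  simp [A, and_assoc]

theorem kk_false_sum (l : Fin n → N) (r : Fin n → ℝ) : ∑ i, kk false l r i = n := by
  have := Finset.card_eq_sum_card_fiberwise (f := l) (s := Finset.univ) (t := Finset.univ) (by simp)
  rw [Finset.card_univ, Fintype.card_fin] at this
  conv_rhs => rw [this]
  simp [kk, Sp]

theorem kk_true {l : Fin n → N} {r : Fin n → ℝ} {a : Fin n} (ha : Sp true r a) :
    kk false l r = kk true l r + Pi.single (l a) 1 := by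
  funext i
  have e : ∀ c, Sp true r c ↔ c = a := fun c => ⟨fun h => Sp_unique h ha, fun h => h ▸ ha⟩
  have e' : ∀ c, ¬ Sp false r c := by simp [Sp]
  simp only [kk, Pi.add_apply, e, e', not_false_eq_true, true_and]
  by_cases hi : l a = i
  · subst hi
    rw [Pi.single_eq_same]
    have : Finset.univ.filter (fun c => l c = l a) = insert a (Finset.univ.filter (fun c => ¬ c = a ∧ l c = l a)) := by
      ext c; simp; tauto
    rw [this, Finset.card_insert_of_notMem (by simp)]
  · rw [Pi.single_eq_of_ne (Ne.symm hi), add_zero]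
    congr 1
    ext c
    simp only [Finset.mem_filter, Finset.mem_univ, true_and]
    constructor
    · rintro rfl
      exact ⟨fun h => hi (by rw [h]), rfl⟩
    · exact fun h => h.2

theorem kk_true_sum {l : Fin n → N} {r : Fin n → ℝ} (h : Ob true r) : ∑ i, kk true l r i = n - 1 := by
  rcases h with ⟨h, _⟩ | ⟨_, a, ha⟩
  · simp at h
  · have h1 := kk_false_sum l r
    rw [kk_true ha] at h1
    simp only [Pi.add_apply, Finset.sum_add_distrib, Finset.sum_pi_single', Finset.mem_univ, if_true] at h1
    have : ∑ x : N, (Pi.single (l a) 1 : N → ℕ) x = 1 := by simp [Finset.sum_pi_single']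
    omega

theorem Sp_perm (b : Bool) (r : Fin n → ℝ) (p : Equiv.Perm (Fin n)) (a : Fin n) :
    Sp b (r ∘ p) a ↔ Sp b r (p a) := by
  refine and_congr_right fun _ => ?_
  constructor
  · intro h c hc
    have := h (p.symm c) (fun h' => hc (by rw [← h']; simp))
    simpa using this
  · intro h c hc
    exact h (p c) (fun h' => hc (p.injective h'))

theorem card_perm (p : Equiv.Perm (Fin n)) (Q Q' : Fin n → Prop) [DecidablePred Q] [DecidablePred Q'] (h : ∀ c, Q' c ↔ Q (p c)) :
    (Finset.univ.filter Q').card = (Finset.univ.filter Q).card := by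
  apply Finset.card_equiv p
  intro c
  simp [h c]

theorem Ob_perm (b : Bool) (r : Fin n → ℝ) (p : Equiv.Perm (Fin n)) : Ob b (r ∘ p) ↔ Ob b r := by
  unfold Ob
  refine or_congr (and_congr_right fun _ => ?_) (and_congr_right fun _ => ?_)
  · exact p.forall_congr (fun {a} => Iff.rfl)
  · exact p.exists_congr (fun {a} => Sp_perm _ _ _ _)

theorem rk_perm (b : Bool) (l : Fin n → N) (r : Fin n → ℝ) (p : Equiv.Perm (Fin n)) (a : Fin n) :
    rk b (l ∘ p) (r ∘ p) a = rk b l r (p a) := by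
  unfold rk
  apply card_perm p
  intro c
  rw [Sp_perm]
  rfl

theorem tg_perm (b : Bool) (s : ℝ) (l : Fin n → N) (r : Fin n → ℝ) (p : Equiv.Perm (Fin n)) (a : Fin n) :
    tg b s (l ∘ p) (r ∘ p) a = tg b s l r (p a) := by
  unfold tg
  simp only [Sp_perm, rk_perm]

theorem kk_perm (b : Bool) (l : Fin n → N) (r : Fin n → ℝ) (p : Equiv.Perm (Fin n)) :
    kk b (l ∘ p) (r ∘ p) = kk b l r := by
  funext i
  unfold kk
  apply card_perm p
  intro c
  rw [Sp_perm]
  rfl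

end Comb
end GraphBraid
end

section
open unitInterval
namespace GraphBraid
open Topology CategoryTheory

set_option linter.unusedSectionVars false
section StarSec
open Classical
variable {N : Type} [Fintype N] [Nonempty N]

/-- the star with legs `N` -/
def Star (N : Type) : Type :=
  {x : N → ℝ // (∀ i, 0 ≤ x i ∧ x i ≤ 1) ∧ ∀ i j, x i ≠ 0 → x j ≠ 0 → i = j}

instance : TopologicalSpace (Star N) := inferInstanceAs (TopologicalSpace (Subtype _))
instance : T2Space (Star N) := inferInstanceAs (T2Space (Subtype _))

noncomputable def rad (x : Star N) : ℝ := ∑ i, x.1 i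
noncomputable def leg (x : Star N) : N :=
  if h : ∃ i, x.1 i ≠ 0 then h.choose else Classical.arbitrary N
noncomputable def sp (i : N) (u : ℝ) : Star N := ⟨Pi.single i (max 0 (min 1 u)), by
  constructor
  · intro j
    by_cases h : j = i
    · subst h; simp
    · simp [Pi.single_eq_of_ne h]
  · intro j k hj hk
    have : ∀ j, (Pi.single i (max 0 (min 1 u)) : N → ℝ) j ≠ 0 → j = i := by
      intro j hj
      by_contra h
      exact hj (Pi.single_eq_of_ne h _)
    rw [this j hj, this k hk]⟩

theorem sp_val (i : N) {u : ℝ} (h0 : 0 ≤ u) (h1 : u ≤ 1) : (sp i u).1 = Pi.single i u := by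
  simp [sp, h0, h1]

theorem star_val (x : Star N) : x.1 = Pi.single (leg x) (x.1 (leg x)) := by
  funext j
  by_cases hj : j = leg x
  · subst hj; simp
  · rw [Pi.single_eq_of_ne hj]
    by_contra h
    have hex : ∃ i, x.1 i ≠ 0 := ⟨j, h⟩
    have hl : leg x = hex.choose := dif_pos hex
    exact hj (by rw [hl]; exact x.2.2 _ _ h hex.choose_spec)

theorem rad_eq (x : Star N) : rad x = x.1 (leg x) := by
  unfold rad
  conv_lhs => rw [star_val x]
  simp

theorem rad_mem (x : Star N) : 0 ≤ rad x ∧ rad x ≤ 1 := by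
  rw [rad_eq]; exact x.2.1 _

theorem star_eq (x : Star N) : x = sp (leg x) (rad x) := by
  apply Subtype.ext
  rw [sp_val _ (rad_mem x).1 (rad_mem x).2, rad_eq]
  exact star_val x

theorem star_ext {x y : Star N} (h : leg x = leg y) (h' : rad x = rad y) : x = y := by
  rw [star_eq x, star_eq y, h, h']

theorem rad_sp (i : N) {u : ℝ} (h0 : 0 ≤ u) (h1 : u ≤ 1) : rad (sp i u) = u := by
  unfold rad
  rw [sp_val i h0 h1]
  simp

theorem leg_eq {x : Star N} {i : N} (h : x.1 i ≠ 0) : leg x = i := by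
  have hex : ∃ i, x.1 i ≠ 0 := ⟨i, h⟩
  have hl : leg x = hex.choose := dif_pos hex
  rw [hl]
  exact x.2.2 _ _ hex.choose_spec h

theorem leg_sp (i : N) {u : ℝ} (h0 : 0 < u) (h1 : u ≤ 1) : leg (sp i u) = i := by
  apply leg_eq
  rw [sp_val i h0.le h1]
  simp [h0.ne']

theorem sp_zero (i j : N) : sp i 0 = sp j 0 := by
  apply Subtype.ext
  simp [sp]

theorem continuous_rad : Continuous (rad : Star N → ℝ) := by
  unfold rad
  refine continuous_finsetSum _ fun i _ => ?_
  exact (continuous_apply i).comp continuous_subtype_val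

theorem leg_loc {x : Star N} (h : 0 < rad x) : ∀ᶠ z in 𝓝 x, leg z = leg x := by
  have hc : Continuous (fun z : Star N => z.1 (leg x)) :=
    (continuous_apply (leg x)).comp continuous_subtype_val
  rw [rad_eq] at h
  filter_upwards [hc.continuousAt.eventually (lt_mem_nhds h)] with z hz
  exact leg_eq hz.ne'

variable {n : ℕ}

/-- ordered configurations -/
abbrev Cfg (n : ℕ) (N : Type) : Type := {f : Fin n → Star N // Function.Injective f}

noncomputable def ll (f : Cfg n N) (a : Fin n) : N := leg (f.1 a)
noncomputable def rr (f : Cfg n N) (a : Fin n) : ℝ := rad (f.1 a)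

theorem rr_nonneg (f : Cfg n N) (a : Fin n) : 0 ≤ rr f a := (rad_mem _).1
theorem rr_mem (f : Cfg n N) (a : Fin n) : 0 ≤ rr f a ∧ rr f a ≤ 1 := rad_mem _

theorem cfg_inj (f : Cfg n N) (a c : Fin n) (h : ll f a = ll f c) (h' : rr f a = rr f c) : a = c :=
  f.2 (star_ext h h')

def Good (b : Bool) (s : ℝ) (f : Cfg n N) : Prop := 0 ≤ s ∧ s < 1 / ((n : ℝ) + 1) ∧ Ob b (rr f)

theorem hom_inj {b : Bool} {s : ℝ} {f : Cfg n N} (h : Good b s f) (t : I) :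
    Function.Injective (fun a => sp (ll f a) (xx b s (ll f) (rr f) t a)) := by
  obtain ⟨hs, hs1, hO⟩ := h
  have ht0 := t.2.1
  have ht1 := t.2.2
  intro a c hac
  have ma := xx_mem (b := b) hs hs1 (l := ll f) ht0 ht1 (rr_mem f) a
  have mc := xx_mem (b := b) hs hs1 (l := ll f) ht0 ht1 (rr_mem f) c
  have hr : xx b s (ll f) (rr f) t a = xx b s (ll f) (rr f) t c := by
    have := congrArg rad hac
    simp only at this
    rwa [rad_sp _ ma.1 ma.2, rad_sp _ mc.1 mc.2] at this
  by_contra hne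
  have hpos : 0 < xx b s (ll f) (rr f) t a := by
    by_cases ha : Sp b (rr f) a
    · have hc : ¬ Sp b (rr f) c := fun hc => hne (Sp_unique ha hc)
      rw [hr]
      exact xx_pos ht0 ht1 (rr_nonneg f) hO hc
    · exact xx_pos ht0 ht1 (rr_nonneg f) hO ha
  have hl : ll f a = ll f c := by
    have := congrArg leg hac
    simp only at this
    rwa [leg_sp _ hpos ma.2, leg_sp _ (hr ▸ hpos) mc.2] at this
  rcases lt_trichotomy (rr f a) (rr f c) with h | h | h
  · exact (xx_mono hs1 ht0 ht1 hl h).ne hr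
  · exact hne (cfg_inj f a c hl h)
  · exact (xx_mono hs1 ht0 ht1 hl.symm h).ne' hr

noncomputable def hom (b : Bool) (s : ℝ) (f : Cfg n N) (t : I) : Cfg n N :=
  if h : Good b s f then ⟨fun a => sp (ll f a) (xx b s (ll f) (rr f) t a), hom_inj h t⟩ else f

theorem hom_apply {b : Bool} {s : ℝ} {f : Cfg n N} (h : Good b s f) (t : I) (a : Fin n) :
    (hom b s f t).1 a = sp (ll f a) (xx b s (ll f) (rr f) t a) := by
  rw [hom, dif_pos h]

theorem rr_hom {b : Bool} {s : ℝ} {f : Cfg n N} (h : Good b s f) (t : I) :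
    rr (hom b s f t) = xx b s (ll f) (rr f) t := by
  funext a
  have ma := xx_mem (b := b) h.1 h.2.1 (l := ll f) t.2.1 t.2.2 (rr_mem f) a
  rw [rr, hom_apply h, rad_sp _ ma.1 ma.2]

theorem ll_hom {b : Bool} {s : ℝ} {f : Cfg n N} (h : Good b s f) (t : I) {a : Fin n}
    (hp : 0 < xx b s (ll f) (rr f) t a) : ll (hom b s f t) a = ll f a := by
  have ma := xx_mem (b := b) h.1 h.2.1 (l := ll f) t.2.1 t.2.2 (rr_mem f) a
  rw [ll, hom_apply h, leg_sp _ hp ma.2]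

theorem hom_good {b : Bool} {s : ℝ} {f : Cfg n N} (h : Good b s f) (t : I) : Good b s (hom b s f t) := by
  refine ⟨h.1, h.2.1, ?_⟩
  rw [rr_hom h]
  exact xx_Ob h.2.1 t.2.1 t.2.2 (rr_nonneg f) h.2.2

theorem hom_zero (b : Bool) (s : ℝ) (f : Cfg n N) : hom b s f 0 = f := by
  by_cases h : Good b s f
  · apply Subtype.ext
    funext a
    rw [hom_apply h]
    simp only [xx, Set.Icc.coe_zero, sub_zero, one_mul, zero_mul, add_zero]
    exact (star_eq _).symm
  · rw [hom, dif_neg h]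

theorem hom_sameType {b : Bool} {s : ℝ} {f : Cfg n N} (h : Good b s f) (t : I) :
    SameType b (ll f) (ll (hom b s f t)) (rr f) (rr (hom b s f t)) := by
  rw [rr_hom h]
  refine ⟨fun a => xx_Sp_iff h.2.1 t.2.1 t.2.2 h.2.2, fun a ha => ?_, fun a c ha hc hl => ?_⟩
  · rw [ll_hom h t (xx_pos t.2.1 t.2.2 (rr_nonneg f) h.2.2 ha)]
  · refine ⟨fun hr => xx_mono h.2.1 t.2.1 t.2.2 hl hr, fun hx => ?_⟩
    rcases lt_trichotomy (rr f a) (rr f c) with h' | h' | h'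
    · exact h'
    · rw [cfg_inj f a c hl h'] at hx
      exact absurd hx (lt_irrefl _)
    · exact absurd hx (xx_mono h.2.1 t.2.1 t.2.2 hl.symm h').not_gt

/-- the endpoint configurations are fixed by the homotopy -/
theorem hom_fixed {b : Bool} {f : Cfg n N} (h : Good b 0 f) (t : I) :
    hom b 0 (hom b 0 f 1) t = hom b 0 f 1 := by
  apply Subtype.ext
  funext a
  have h1 := hom_good h 1
  have hr : rr (hom b 0 f 1) a = tg b 0 (ll f) (rr f) a := by
    rw [rr_hom h]; simp [xx]
  have ht : tg b 0 (ll (hom b 0 f 1)) (rr (hom b 0 f 1)) a = tg b 0 (ll f) (rr f) a :=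
    ((hom_sameType h 1).tg a).symm
  rw [hom_apply h1]
  have : xx b 0 (ll (hom b 0 f 1)) (rr (hom b 0 f 1)) t a = rr (hom b 0 f 1) a := by
    rw [xx, ht, hr]; ring
  rw [this]
  exact (star_eq _).symm

/-- action of permutations -/
def act (f : Cfg n N) (p : Equiv.Perm (Fin n)) : Cfg n N := ⟨f.1 ∘ p, f.2.comp p.injective⟩

theorem hom_act (b : Bool) (s : ℝ) (f : Cfg n N) (p : Equiv.Perm (Fin n)) (t : I) :
    hom b s (act f p) t = act (hom b s f t) p := by
  have hg : Good b s (act f p) ↔ Good b s f :=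
    and_congr_right fun _ => and_congr_right fun _ => Ob_perm b (rr f) p
  by_cases h : Good b s f
  · apply Subtype.ext
    funext a
    rw [hom_apply (hg.mpr h)]
    change _ = (hom b s f t).1 (p a)
    rw [hom_apply h]
    have : xx b s (ll (act f p)) (rr (act f p)) t a = xx b s (ll f) (rr f) t (p a) := by
      have := tg_perm b s (ll f) (rr f) p a
      simp only [xx]
      congr 2
    rw [this]
    rfl
  · rw [hom, dif_neg (fun h' => h (hg.mp h')), hom, dif_neg h]

theorem continuous_rr (a : Fin n) : Continuous (fun f : Cfg n N => rr f a) :=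
  continuous_rad.comp ((continuous_apply a).comp continuous_subtype_val)

theorem Ob_open {b : Bool} {f : Cfg n N} (h : Ob b (rr f)) : ∀ᶠ g in 𝓝 f, Ob b (rr g) := by
  rcases h with ⟨rfl, h⟩ | ⟨rfl, a0, h⟩
  · have : ∀ᶠ g in 𝓝 f, ∀ a, 0 < rr g a := by
      rw [Filter.eventually_all]
      intro a
      exact (continuous_rr a).continuousAt.eventually (lt_mem_nhds (h a))
    filter_upwards [this] with g hg
    exact Or.inl ⟨rfl, hg⟩
  · have : ∀ᶠ g in 𝓝 f, ∀ c, c ≠ a0 → rr g a0 < rr g c := by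
      rw [Filter.eventually_all]
      intro a
      rw [Filter.eventually_imp_distrib_left]
      intro ha
      exact ((continuous_rr a0).continuousAt.eventually_lt (continuous_rr a).continuousAt (h.2 a ha))
    filter_upwards [this] with g hg
    exact Or.inr ⟨rfl, a0, rfl, hg⟩

theorem sp_eventually {f : Cfg n N} {a0 : Fin n} (h : Sp true (rr f) a0) :
    ∀ᶠ g in 𝓝 f, Sp true (rr g) a0 := by
  have : ∀ᶠ g in 𝓝 f, ∀ c, c ≠ a0 → rr g a0 < rr g c := by
    rw [Filter.eventually_all]
    intro a
    rw [Filter.eventually_imp_distrib_left]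
    intro ha
    exact ((continuous_rr a0).continuousAt.eventually_lt (continuous_rr a).continuousAt (h.2 a ha))
  filter_upwards [this] with g hg
  exact ⟨rfl, hg⟩

theorem ll_loc {f : Cfg n N} {a : Fin n} (h : 0 < rr f a) : ∀ᶠ g in 𝓝 f, ll g a = ll f a := by
  have : ContinuousAt (fun g : Cfg n N => g.1 a) f :=
    ((continuous_apply a).comp continuous_subtype_val).continuousAt
  exact this.eventually (leg_loc h)

theorem sameType_eventually {b : Bool} {f : Cfg n N} (h : Ob b (rr f)) :
    ∀ᶠ g in 𝓝 f, SameType b (ll f) (ll g) (rr f) (rr g) := by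
  have e1 : ∀ᶠ g in 𝓝 f, ∀ a, Sp b (rr f) a ↔ Sp b (rr g) a := by
    rcases h with ⟨rfl, h⟩ | ⟨rfl, a0, h⟩
    · exact Filter.Eventually.of_forall fun g a => by simp [Sp]
    · filter_upwards [sp_eventually h] with g hg a
      constructor
      · intro h'; rwa [Sp_unique h' h]
      · intro h'; rwa [Sp_unique h' hg]
  have e2 : ∀ᶠ g in 𝓝 f, ∀ a, ¬ Sp b (rr f) a → ll g a = ll f a := by
    rw [Filter.eventually_all]
    intro a
    rw [Filter.eventually_imp_distrib_left]
    intro ha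
    exact ll_loc (nonSp_pos (rr_nonneg f) h ha)
  have e3 : ∀ᶠ g in 𝓝 f, ∀ a c, rr f a < rr f c → rr g a < rr g c := by
    rw [Filter.eventually_all]
    intro a
    rw [Filter.eventually_all]
    intro c
    rw [Filter.eventually_imp_distrib_left]
    intro ha
    exact ((continuous_rr a).continuousAt.eventually_lt (continuous_rr c).continuousAt ha)
  filter_upwards [e1, e2, e3] with g h1 h2 h3
  refine ⟨h1, fun a ha => (h2 a ha).symm, fun a c ha hc hl => ⟨h3 a c, fun hx => ?_⟩⟩
  rcases lt_trichotomy (rr f a) (rr f c) with h' | h' | h'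
  · exact h'
  · rw [cfg_inj f a c hl h'] at hx
    exact absurd hx (lt_irrefl _)
  · exact absurd hx (h3 _ _ h').not_gt

/-- the target of a configuration is locally constant -/
theorem target_loc {b : Bool} {s : ℝ} {f : Cfg n N} (h : Good b s f)
    (h' : s = 0 ∨ ∀ a, 0 < rr f a) :
    ∀ᶠ g in 𝓝 f, ∀ a, sp (ll g a) (tg b s (ll g) (rr g) a) = sp (ll f a) (tg b s (ll f) (rr f) a) := by
  have e : ∀ᶠ g in 𝓝 f, ∀ a, 0 < rr f a → ll g a = ll f a := by
    rw [Filter.eventually_all]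
    intro a
    rw [Filter.eventually_imp_distrib_left]
    exact ll_loc
  filter_upwards [sameType_eventually h.2.2, e] with g hg he a
  rw [← hg.tg a]
  by_cases ha : Sp b (rr f) a
  · rcases h' with rfl | h'
    · have : tg b 0 (ll f) (rr f) a = 0 := if_pos ha
      rw [this]
      exact sp_zero _ _
    · rw [he a (h' a)]
  · rw [hg.2.1 a ha]

theorem hom_coord {b : Bool} {s : ℝ} {f : Cfg n N} (h : Good b s f) (t : I) (a : Fin n) (i : N) :
    ((hom b s f t).1 a).1 i = (1 - (t : ℝ)) * (f.1 a).1 i +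
      (t : ℝ) * (sp (ll f a) (tg b s (ll f) (rr f) a)).1 i := by
  have ma := xx_mem (b := b) h.1 h.2.1 (l := ll f) t.2.1 t.2.2 (rr_mem f) a
  have mt := tg_mem (b := b) h.1 h.2.1 (ll f) (rr f) a
  have e : (f.1 a).1 = Pi.single (ll f a) (rr f a) := by
    have := star_val (f.1 a)
    rw [← rad_eq] at this
    exact this
  rw [hom_apply h, sp_val _ ma.1 ma.2, sp_val _ mt.1 mt.2, e, xx]
  by_cases hi : i = ll f a
  · subst hi; simp
  · simp [Pi.single_eq_of_ne hi]

theorem hom_cont {b : Bool} {s : ℝ} {f : Cfg n N} (h : Good b s f)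
    (h' : s = 0 ∨ ∀ a, 0 < rr f a) (t : I) :
    ContinuousAt (fun p : Cfg n N × I => hom b s p.1 p.2) (f, t) := by
  have hi0 : Topology.IsInducing (Subtype.val : Cfg n N → Fin n → Star N) := ⟨rfl⟩
  rw [hi0.continuousAt_iff, continuousAt_pi]
  intro a
  have hi : Topology.IsInducing (fun x : Star N => x.1) := ⟨rfl⟩
  refine hi.continuousAt_iff.mpr ?_
  rw [continuousAt_pi]
  intro i
  have hg : ∀ᶠ p : Cfg n N × I in 𝓝 (f, t), Good b s p.1 ∧
      ∀ a, sp (ll p.1 a) (tg b s (ll p.1) (rr p.1) a) = sp (ll f a) (tg b s (ll f) (rr f) a) := by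
    have : ∀ᶠ g in 𝓝 f, Good b s g ∧
      ∀ a, sp (ll g a) (tg b s (ll g) (rr g) a) = sp (ll f a) (tg b s (ll f) (rr f) a) := by
      filter_upwards [Ob_open h.2.2, target_loc h h'] with g h1 h2
      exact ⟨⟨h.1, h.2.1, h1⟩, h2⟩
    have hfst : Filter.Tendsto (fun p : Cfg n N × I => p.1) (𝓝 (f, t)) (𝓝 f) :=
      continuous_fst.tendsto (f, t)
    exact hfst.eventually this
  have hc : ContinuousAt (fun p : Cfg n N × I => (1 - (p.2 : ℝ)) * (p.1.1 a).1 i +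
      (p.2 : ℝ) * (sp (ll f a) (tg b s (ll f) (rr f) a)).1 i) (f, t) := by
    have h1 : Continuous (fun p : Cfg n N × I => (p.1.1 a).1 i) :=
      (continuous_apply i).comp (continuous_subtype_val.comp
        ((continuous_apply a).comp (continuous_subtype_val.comp continuous_fst)))
    have h2 : Continuous (fun p : Cfg n N × I => (p.2 : ℝ)) := continuous_subtype_val.comp continuous_snd
    exact (((continuous_const.sub h2).mul h1).add (h2.mul continuous_const)).continuousAt
  refine hc.congr ?_
  filter_upwards [hg] with p hp
  simp only [Function.comp]
  rw [hom_coord hp.1, hp.2 a]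

end StarSec
end GraphBraid
end

section
open unitInterval
namespace GraphBraid
open Topology CategoryTheory

set_option linter.unusedSectionVars false
section StarConf
open Classical
variable {N : Type} [Fintype N] [Nonempty N] {n : ℕ}

theorem permRel_act {X : Type} {f g : {f : Fin n → X // Function.Injective f}} (h : PermRel n X f g) :
    ∃ p : Equiv.Perm (Fin n), g = ⟨f.1 ∘ p, f.2.comp p.injective⟩ := by
  obtain ⟨p, hp⟩ := h
  exact ⟨p, Subtype.ext hp.symm⟩

theorem mk_eq_of_range {X : Type} [TopologicalSpace X] {f g : {f : Fin n → X // Function.Injective f}}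
    (h : Set.range f.1 = Set.range g.1) : (Quot.mk _ f : UConf n X) = Quot.mk _ g := by
  apply Quot.sound
  let p : Equiv.Perm (Fin n) := (Equiv.ofInjective g.1 g.2).trans
    ((Equiv.setCongr h.symm).trans (Equiv.ofInjective f.1 f.2).symm)
  refine ⟨p, ?_⟩
  funext a
  simp only [p, Function.comp, Equiv.trans_apply]
  exact Equiv.apply_ofInjective_symm f.2 _

theorem isOpenQuotientMap_mk (n : ℕ) (X : Type) [TopologicalSpace X] :
    IsOpenQuotientMap (Quot.mk (PermRel n X) : _ → UConf n X) := by
  refine ⟨Quot.mk_surjective, continuous_quot_mk, ?_⟩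
  intro U hU
  have hq : Topology.IsQuotientMap (Quot.mk (PermRel n X)) := isQuotientMap_quot_mk
  rw [← hq.isOpen_preimage]
  have e : Quot.mk (PermRel n X) ⁻¹' (Quot.mk (PermRel n X) '' U) =
      ⋃ p : Equiv.Perm (Fin n), {f | (⟨f.1 ∘ p, f.2.comp p.injective⟩ : {f : Fin n → X // Function.Injective f}) ∈ U} := by
    ext f
    simp only [Set.mem_preimage, Set.mem_image, Set.mem_iUnion, Set.mem_ofPred_eq]
    constructor
    · rintro ⟨g, hg, hgf⟩
      have heq : Equivalence (PermRel n X) := by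
        refine ⟨fun x => ⟨1, rfl⟩, ?_, ?_⟩
        · rintro x y ⟨p, hp⟩
          refine ⟨p.symm, ?_⟩
          rw [← hp]; funext a; simp
        · rintro x y z ⟨p, hp⟩ ⟨q, hq⟩
          refine ⟨q.trans p, ?_⟩
          rw [← hq, ← hp]; rfl
      have := (heq.quot_mk_eq_iff f g).mp hgf.symm
      obtain ⟨p, hp⟩ := permRel_act this
      exact ⟨p, hp ▸ hg⟩
    · rintro ⟨p, hp⟩
      exact ⟨_, hp, (Quot.sound ⟨p, rfl⟩ : Quot.mk (PermRel n X) f = Quot.mk (PermRel n X) _).symm⟩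
  rw [e]
  refine isOpen_iUnion fun p => hU.preimage ?_
  refine Continuous.subtype_mk ?_ _
  exact continuous_pi fun a => (continuous_apply (p a)).comp continuous_subtype_val

/-- labels -/
abbrev Cnt (N : Type) [Fintype N] (k : ℕ) : Type := {m : N → ℕ // ∑ i, m i = k}

noncomputable instance (k : ℕ) : Inhabited (Cnt N k) :=
  ⟨⟨Pi.single (Classical.arbitrary N) k, by simp⟩⟩

noncomputable def labc (b : Bool) (f : Cfg n N) : Cnt N n ⊕ Cnt N (n - 1) :=
  if b = true then
    .inr (if h : ∑ i, kk true (ll f) (rr f) i = n - 1 then ⟨kk true (ll f) (rr f), h⟩ else default)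
  else .inl ⟨kk false (ll f) (rr f), kk_false_sum _ _⟩

theorem labc_congr {b : Bool} {f g : Cfg n N} (h : kk b (ll f) (rr f) = kk b (ll g) (rr g)) :
    labc b f = labc b g := by
  rcases b with _ | _
  · simp only [labc]
    simp [h]
  · simp only [labc, h]
    simp

theorem labc_act (b : Bool) (f : Cfg n N) (p : Equiv.Perm (Fin n)) : labc b (act f p) = labc b f :=
  labc_congr (kk_perm b (ll f) (rr f) p)

theorem labc_false_inj {f g : Cfg n N} (h : labc false f = labc false g) :
    kk false (ll f) (rr f) = kk false (ll g) (rr g) := by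
  simp only [labc] at h
  simpa using h

theorem labc_true_eq {f : Cfg n N} (h : Ob true (rr f)) :
    labc true f = .inr ⟨kk true (ll f) (rr f), kk_true_sum h⟩ := by
  simp [labc, kk_true_sum h]

theorem labc_inj {b : Bool} {f g : Cfg n N} (hf : Ob b (rr f)) (hg : Ob b (rr g))
    (h : labc b f = labc b g) : kk b (ll f) (rr f) = kk b (ll g) (rr g) := by
  rcases b with _ | _
  · exact labc_false_inj h
  · rw [labc_true_eq hf, labc_true_eq hg] at h
    simpa using h

/-- leg of the special point -/
noncomputable def sleg (f : Cfg n N) : N :=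
  if h : ∃ a, Sp true (rr f) a then ll f h.choose else Classical.arbitrary N

theorem sleg_eq {f : Cfg n N} {a : Fin n} (h : Sp true (rr f) a) : sleg f = ll f a := by
  have hex : ∃ a, Sp true (rr f) a := ⟨a, h⟩
  rw [sleg, dif_pos hex, Sp_unique hex.choose_spec h]

theorem sleg_act (f : Cfg n N) (p : Equiv.Perm (Fin n)) : sleg (act f p) = sleg f := by
  have hp : ∀ a, Sp true (rr (act f p)) a ↔ Sp true (rr f) (p a) := Sp_perm true (rr f) p
  by_cases h : ∃ a, Sp true (rr (act f p)) a
  · obtain ⟨a, ha⟩ := h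
    rw [sleg_eq ha, sleg_eq ((hp a).mp ha)]
    rfl
  · have h' : ¬ ∃ a, Sp true (rr f) a := by
      rintro ⟨a, ha⟩
      exact h ⟨p.symm a, by rw [hp]; simpa using ha⟩
    rw [sleg, dif_neg h, sleg, dif_neg h']

theorem target_range {b : Bool} {s : ℝ} {f : Cfg n N} (h : Good b s f) :
    Set.range (hom b s f 1).1 = {x | (∃ i j, j < kk b (ll f) (rr f) i ∧ x = sp i (((j : ℝ) + 1) / (n + 1))) ∨
      ∃ a, Sp b (rr f) a ∧ x = sp (ll f a) s} := by
  have hv : ∀ a, (hom b s f 1).1 a = sp (ll f a) (tg b s (ll f) (rr f) a) := by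
    intro a
    rw [hom_apply h]
    simp [xx]
  ext x
  simp only [Set.mem_range, Set.mem_ofPred_eq]
  constructor
  · rintro ⟨a, rfl⟩
    rw [hv]
    by_cases ha : Sp b (rr f) a
    · right
      exact ⟨a, ha, by rw [tg, if_pos ha]⟩
    · left
      exact ⟨ll f a, rk b (ll f) (rr f) a, (rk_range (cfg_inj f) _ _).mp ⟨a, ha, rfl, rfl⟩,
        by rw [tg, if_neg ha]⟩
  · rintro (⟨i, j, hj, rfl⟩ | ⟨a, ha, rfl⟩)
    · obtain ⟨a, ha, hl, hr⟩ := (rk_range (cfg_inj f) i j).mpr hj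
      exact ⟨a, by rw [hv, tg, if_neg ha, hl, hr]⟩
    · exact ⟨a, by rw [hv, tg, if_pos ha]⟩

/-- class of a configuration -/
def cmk (f : Cfg n N) : UConf n (Star N) := Quot.mk _ f

theorem cmk_act (f : Cfg n N) (p : Equiv.Perm (Fin n)) : cmk (act f p) = cmk f :=
  (Quot.sound ⟨p, rfl⟩ : Quot.mk (PermRel n (Star N)) f = Quot.mk (PermRel n (Star N)) (act f p)).symm

theorem target_eq {b : Bool} {s : ℝ} {f g : Cfg n N} (hf : Good b s f) (hg : Good b s g)
    (h : kk b (ll f) (rr f) = kk b (ll g) (rr g))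
    (h' : s = 0 ∨ sleg f = sleg g) : cmk (hom b s f 1) = cmk (hom b s g 1) := by
  apply mk_eq_of_range
  rw [target_range hf, target_range hg, h]
  ext x
  simp only [Set.mem_ofPred_eq]
  refine or_congr Iff.rfl ?_
  have key : ∀ f g : Cfg n N, Good b s f → Good b s g → (s = 0 ∨ sleg f = sleg g) →
      (∃ a, Sp b (rr f) a ∧ x = sp (ll f a) s) → ∃ a, Sp b (rr g) a ∧ x = sp (ll g a) s := by
    rintro f g hf hg h' ⟨a, ha, rfl⟩
    rcases hg.2.2 with ⟨rfl, _⟩ | ⟨rfl, c, hc⟩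
    · simp [Sp] at ha
    · refine ⟨c, hc, ?_⟩
      rcases h' with rfl | h'
      · exact sp_zero _ _
      · rw [sleg_eq ha, sleg_eq hc] at h'
        rw [h']
  exact ⟨key f g hf hg h', key g f hg hf (h'.imp id Eq.symm)⟩

theorem exists_cfg (hn : 1 ≤ n) (m : Cnt N (n - 1)) (i : N) :
    ∃ f : Cfg n N, Ob true (rr f) ∧ Ob false (rr f) ∧ kk true (ll f) (rr f) = m.1 ∧ sleg f = i := by
  let T := Option (Σ i : N, Fin (m.1 i))
  have hcard : Fintype.card T = n := by
    simp only [T, Fintype.card_option, Fintype.card_sigma, Fintype.card_fin]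
    rw [m.2]; omega
  let e : Fin n ≃ T := (Fintype.equivFinOfCardEq hcard).symm
  let L : T → N := fun x => x.elim i (fun p => p.1)
  let R : T → ℝ := fun x => x.elim (1 / (2 * ((n : ℝ) + 1))) (fun p => ((p.2 : ℕ) + 1 : ℝ) / (n + 1))
  have hnp : (0 : ℝ) < n + 1 := by positivity
  have hR : ∀ x, 0 < R x ∧ R x ≤ 1 := by
    rintro (_ | ⟨i, j⟩)
    · simp only [R, Option.elim]
      refine ⟨by positivity, ?_⟩
      rw [div_le_one (by positivity)]
      linarith [(Nat.cast_nonneg n : (0 : ℝ) ≤ n)]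
    · simp only [R, Option.elim]
      refine ⟨by positivity, ?_⟩
      rw [div_le_one hnp]
      have h1 : m.1 i ≤ n - 1 := by
        refine le_of_le_of_eq ?_ m.2
        exact Finset.single_le_sum (f := m.1) (fun _ _ => Nat.zero_le _) (Finset.mem_univ i)
      have h2 : (j : ℕ) ≤ n := by have := j.2; omega
      have : ((j : ℕ) : ℝ) ≤ n := by exact_mod_cast h2
      linarith
  have hR0 : ∀ p, R none < R (some p) := by
    rintro ⟨i, j⟩
    simp only [R, Option.elim]
    rw [div_lt_div_iff₀ (by positivity) hnp]
    have : (0 : ℝ) ≤ (j : ℕ) := Nat.cast_nonneg _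
    nlinarith
  let F : Fin n → Star N := fun a => sp (L (e a)) (R (e a))
  have hrF : ∀ a, rad (F a) = R (e a) := fun a => rad_sp _ (hR _).1.le (hR _).2
  have hlF : ∀ a, leg (F a) = L (e a) := fun a => leg_sp _ (hR _).1 (hR _).2
  have hF : Function.Injective F := by
    intro a c hac
    apply e.injective
    have h1 : R (e a) = R (e c) := by rw [← hrF, ← hrF, hac]
    have h2 : L (e a) = L (e c) := by rw [← hlF, ← hlF, hac]
    revert h1 h2
    generalize e a = x
    generalize e c = y
    rcases x with _ | ⟨i, j⟩ <;> rcases y with _ | ⟨i', j'⟩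
    · intros; rfl
    · intro h; exact absurd h (hR0 _).ne
    · intro h; exact absurd h (hR0 _).ne'
    · intro h1 h2
      simp only [L, Option.elim] at h2
      subst h2
      simp only [R, Option.elim] at h1
      rw [div_left_inj' hnp.ne'] at h1
      have : j = j' := by
        apply Fin.ext
        have : ((j : ℕ) : ℝ) = (j' : ℕ) := by linarith
        exact_mod_cast this
      rw [this]
  let f : Cfg n N := ⟨F, hF⟩
  have hrf : rr f = fun a => R (e a) := funext hrF
  have hlf : ll f = fun a => L (e a) := funext hlF
  have hsp : Sp true (rr f) (e.symm none) := by
    refine ⟨rfl, fun c hc => ?_⟩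
    rw [hrf]
    simp only [Equiv.apply_symm_apply]
    have : e c ≠ none := fun h => hc (by rw [← h]; simp)
    obtain ⟨p, hp⟩ := Option.ne_none_iff_exists'.mp this
    rw [hp]
    exact hR0 p
  refine ⟨f, Or.inr ⟨rfl, _, hsp⟩, Or.inl ⟨rfl, fun a => ?_⟩, ?_, ?_⟩
  · rw [hrf]; exact (hR _).1
  · funext k
    have hiff : ∀ c, Sp true (rr f) c ↔ e c = none := by
      intro c
      constructor
      · intro h; rw [Sp_unique h hsp]; simp
      · intro h
        have : c = e.symm none := by rw [← h]; simp
        rwa [this]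
    unfold kk
    simp only [hiff, hlf]
    have : (Finset.univ.filter (fun c : Fin n => ¬ e c = none ∧ L (e c) = k)) =
        (Finset.univ : Finset (Fin (m.1 k))).map ⟨fun j => e.symm (some ⟨k, j⟩), by
          intro j j' h
          have h2 := Option.some_injective _ (e.symm.injective h)
          exact eq_of_heq (Sigma.mk.inj h2).2⟩ := by
      ext c
      simp only [Finset.mem_filter, Finset.mem_univ, true_and, Finset.mem_map]
      constructor
      · rintro ⟨h1, h2⟩
        obtain ⟨⟨i, j⟩, hp⟩ := Option.ne_none_iff_exists'.mp h1
        rw [hp] at h2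
        simp only [L, Option.elim] at h2
        subst h2
        refine ⟨j, ?_⟩
        change e.symm (some ⟨_, j⟩) = c
        rw [← hp, Equiv.symm_apply_apply]
      · rintro ⟨j, rfl⟩
        change ¬ e (e.symm (some ⟨k, j⟩)) = none ∧ L (e (e.symm (some ⟨k, j⟩))) = k
        rw [Equiv.apply_symm_apply]
        simp [L]
    rw [this]
    simp
  · rw [sleg_eq hsp, hlf]
    simp [L]

end StarConf
end GraphBraid
end

section
open unitInterval
namespace GraphBraid
open Topology CategoryTheory

set_option linter.unusedSectionVars false
section StarVK
open Classical
variable {N : Type} [Fintype N] [Nonempty N] {n : ℕ}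

theorem lift_wd {α : Sort*} (F : Cfg n N → α) (h : ∀ f p, F (act f p) = F f) (f g : Cfg n N)
    (hfg : PermRel n (Star N) f g) : F f = F g := by
  obtain ⟨p, rfl⟩ := permRel_act hfg
  exact (h f p).symm

/-- the charts -/
def OY (b : Bool) : Set (UConf n (Star N)) :=
  {y | Quot.lift (fun f : Cfg n N => Ob b (rr f)) (lift_wd _ fun f p => propext (Ob_perm b (rr f) p)) y}

theorem mem_OY {b : Bool} {f : Cfg n N} : cmk f ∈ OY b ↔ Ob b (rr f) := Iff.rfl

noncomputable def labY (b : Bool) (y : UConf n (Star N)) : Cnt N n ⊕ Cnt N (n - 1) :=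
  Quot.lift (labc b) (lift_wd _ (labc_act b)) y

noncomputable def HY (b : Bool) (s : ℝ) (y : UConf n (Star N)) (t : I) : UConf n (Star N) :=
  Quot.lift (fun f => cmk (hom b s f t)) (lift_wd _ fun f p => by rw [hom_act, cmk_act]) y

noncomputable def epsc (f : Cfg n N) : Cnt N (n - 1) × N :=
  ((labc true f).elim (fun _ => default) id, sleg f)

noncomputable def epsY (y : UConf n (Star N)) : Cnt N (n - 1) × N :=
  Quot.lift epsc (lift_wd _ fun f p => by rw [epsc, labc_act, sleg_act]; rfl) y

theorem good_zero {b : Bool} {f : Cfg n N} (h : Ob b (rr f)) : Good b 0 f :=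
  ⟨le_rfl, by positivity, h⟩

theorem epsc_fst {f : Cfg n N} (h : Ob true (rr f)) :
    (epsc f).1 = ⟨kk true (ll f) (rr f), kk_true_sum h⟩ := by
  rw [epsc, labc_true_eq h]; rfl

noncomputable def clV : Cnt N n ⊕ Cnt N (n - 1) → Bool := Sum.elim (fun _ => false) (fun _ => true)
noncomputable def srcE (e : Cnt N (n - 1) × N) : Cnt N n ⊕ Cnt N (n - 1) := .inr e.1
noncomputable def tgtE (hn : 1 ≤ n) (e : Cnt N (n - 1) × N) : Cnt N n ⊕ Cnt N (n - 1) :=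
  .inl ⟨e.1.1 + Pi.single e.2 1, by
    simp only [Pi.add_apply, Finset.sum_add_distrib, e.1.2]
    simp
    omega⟩

theorem cl_labc (b : Bool) (f : Cfg n N) : clV (labc b f) = b := by
  rcases b with _ | _
  · simp [labc, clV]
  · simp [labc, clV]

theorem eps_tgt (hn : 1 ≤ n) {f : Cfg n N} (h : Ob true (rr f)) : labc false f = tgtE hn (epsc f) := by
  rcases id h with ⟨h', _⟩ | ⟨_, a, ha⟩
  · simp at h'
  · unfold tgtE
    simp only [epsc_fst h]
    simp only [epsc, sleg_eq ha]
    simp [labc, kk_true ha]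

theorem exists_rep (hn : 1 ≤ n) (v : Cnt N n ⊕ Cnt N (n - 1)) :
    ∃ f : Cfg n N, Ob (clV v) (rr f) ∧ labc (clV v) f = v := by
  rcases v with m | m
  · have : ∃ i, 0 < m.1 i := by
      by_contra hcon
      push Not at hcon
      have h2 := m.2
      rw [Finset.sum_eq_zero (fun i _ => Nat.le_zero.mp (hcon i))] at h2
      omega
    obtain ⟨i, hi⟩ := this
    have hm : m.1 = (m.1 - Pi.single i 1) + Pi.single i 1 := by
      funext j
      by_cases h : j = i
      · subst h; simp; omega
      · simp [Pi.single_eq_of_ne h]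
    have hs : ∑ j, (m.1 - Pi.single i 1 : N → ℕ) j = n - 1 := by
      have h2 := m.2
      rw [hm] at h2
      simp only [Pi.add_apply, Finset.sum_add_distrib] at h2
      have : ∑ x : N, (Pi.single i 1 : N → ℕ) x = 1 := by simp
      omega
    obtain ⟨f, h1, h2, h3, h4⟩ := exists_cfg hn ⟨_, hs⟩ i
    refine ⟨f, h2, ?_⟩
    change labc false f = _
    rw [eps_tgt hn h1, tgtE]
    congr 1
    apply Subtype.ext
    have h5 : epsc f = (⟨_, hs⟩, i) := Prod.ext (by rw [epsc_fst h1]; exact Subtype.ext h3) h4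
    rw [h5]
    exact hm.symm
  · obtain ⟨f, h1, h2, h3, h4⟩ := exists_cfg hn m (Classical.arbitrary N)
    refine ⟨f, h1, ?_⟩
    change labc true f = _
    rw [labc_true_eq h1]
    congr 1
    exact Subtype.ext h3

noncomputable def repV (hn : 1 ≤ n) (v : Cnt N n ⊕ Cnt N (n - 1)) : Cfg n N := (exists_rep hn v).choose
theorem repV_Ob (hn : 1 ≤ n) (v : Cnt N n ⊕ Cnt N (n - 1)) : Ob (clV v) (rr (repV hn v)) :=
  (exists_rep hn v).choose_spec.1
theorem repV_lab (hn : 1 ≤ n) (v : Cnt N n ⊕ Cnt N (n - 1)) : labc (clV v) (repV hn v) = v :=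
  (exists_rep hn v).choose_spec.2

theorem eventually_cmk {f : Cfg n N} {P : UConf n (Star N) → Prop} (h : ∀ᶠ g in 𝓝 f, P (cmk g)) :
    ∀ᶠ z in 𝓝 (cmk f), P z := by
  have := (isOpenQuotientMap_mk n (Star N)).map_nhds_eq f
  change ∀ᶠ z in 𝓝 (Quot.mk _ f), P z
  rw [← this]
  exact h

theorem HY_contAt {b : Bool} {s : ℝ} {f : Cfg n N} (h : Good b s f)
    (h' : s = 0 ∨ ∀ a, 0 < rr f a) (t : I) :
    ContinuousAt (fun p : UConf n (Star N) × I => HY b s p.1 p.2) (cmk f, t) := by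
  have hq := (isOpenQuotientMap_mk n (Star N)).prodMap (IsOpenQuotientMap.id (X := I))
  refine (hq.continuousAt_comp_iff (x := (f, t))).mp ?_
  exact continuous_quot_mk.continuousAt.comp (hom_cont h h' t)

theorem Ob_false_iff {r : Fin n → ℝ} : Ob false r ↔ ∀ a, 0 < r a := by simp [Ob]
theorem Ob_true_iff {r : Fin n → ℝ} : Ob true r ↔ ∃ a, Sp true r a := by simp [Ob]

theorem sleg_loc {f : Cfg n N} (h : Ob true (rr f)) (h' : Ob false (rr f)) :
    ∀ᶠ g in 𝓝 f, sleg g = sleg f := by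
  obtain ⟨a, ha⟩ := Ob_true_iff.mp h
  filter_upwards [sp_eventually ha, ll_loc (Ob_false_iff.mp h' a)] with g h1 h2
  rw [sleg_eq h1, sleg_eq ha, h2]

theorem exists_min_cover (f : Cfg n N) : ∃ b, Ob b (rr f) := by
  by_cases h : ∀ a, 0 < rr f a
  · exact ⟨false, Ob_false_iff.mpr h⟩
  · push Not at h
    obtain ⟨a, ha⟩ := h
    have ha : rr f a = 0 := le_antisymm ha (rr_nonneg f a)
    refine ⟨true, Ob_true_iff.mpr ⟨a, rfl, fun c hc => ?_⟩⟩
    rw [ha]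
    refine lt_of_le_of_ne (rr_nonneg f c) fun h => hc ?_
    apply f.2
    rw [star_eq (f.1 c), star_eq (f.1 a)]
    change sp _ (rr f c) = sp _ (rr f a)
    rw [ha, ← h]
    exact sp_zero _ _

theorem path_mid {f : Cfg n N} (h : Ob true (rr f)) (h' : Ob false (rr f)) (s : ℝ)
    (hs : 0 < s) (hs1 : s < 1 / ((n : ℝ) + 1)) :
    ∃ γ : Path (cmk f) (cmk (hom true s f 1)), ∀ t b, γ t ∈ OY b := by
  have hg : Good true s f := ⟨hs.le, hs1, h⟩
  have hc : Continuous (fun t : I => hom true s f t) := by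
    rw [continuous_iff_continuousAt]
    intro t
    exact (hom_cont hg (Or.inr (Ob_false_iff.mp h')) t).comp
      (f := fun t : I => (f, t)) (by fun_prop : Continuous fun t : I => (f, t)).continuousAt
  refine ⟨{ toFun := fun t => cmk (hom true s f t)
            continuous_toFun := continuous_quot_mk.comp hc
            source' := by rw [hom_zero]
            target' := rfl }, ?_⟩
  intro t b
  change Ob b (rr (hom true s f t))
  rcases b with _ | _
  · rw [rr_hom hg, Ob_false_iff]
    intro a
    have hp := Ob_false_iff.mp h' a
    have ht : 0 < tg true s (ll f) (rr f) a := by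
      by_cases ha : Sp true (rr f) a
      · rw [tg, if_pos ha]; exact hs
      · exact tg_nonSp_pos ha
    have := comb_lt t.2.1 t.2.2 hp ht
    simpa [xx] using this
  · exact (hom_good hg t).2.2

theorem conn_mid {f g : Cfg n N} (hf : Ob true (rr f)) (hf' : Ob false (rr f))
    (hg : Ob true (rr g)) (hg' : Ob false (rr g)) (h : epsc f = epsc g) :
    ∃ γ : Path (cmk f) (cmk g), ∀ t b, γ t ∈ OY b := by
  have hs : (0 : ℝ) < 1 / (2 * ((n : ℝ) + 1)) := by positivity
  have hs1 : 1 / (2 * ((n : ℝ) + 1)) < 1 / ((n : ℝ) + 1) := by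
    apply one_div_lt_one_div_of_lt (by positivity)
    linarith [(Nat.cast_nonneg n : (0 : ℝ) ≤ n)]
  obtain ⟨γ, hγ⟩ := path_mid hf hf' _ hs hs1
  obtain ⟨δ, hδ⟩ := path_mid hg hg' _ hs hs1
  have e := target_eq (b := true) ⟨hs.le, hs1, hf⟩ ⟨hs.le, hs1, hg⟩ (by
    have := congrArg Prod.fst h
    rw [epsc_fst hf, epsc_fst hg] at this
    exact congrArg Subtype.val this) (Or.inr (congrArg Prod.snd h))
  refine ⟨γ.trans ((δ.symm).cast e rfl), ?_⟩
  intro t b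
  rw [Path.trans_apply]
  split_ifs
  · exact hγ _ _
  · exact hδ _ _

/-- the van Kampen data of the star -/
noncomputable def starVK (hn : 1 ≤ n) :
    VK (UConf n (Star N)) (Cnt N n ⊕ Cnt N (n - 1)) (Cnt N (n - 1) × N) where
  O := OY
  isOpen := by
    intro b
    rw [isOpen_iff_mem_nhds]
    rintro ⟨f⟩ hf
    exact eventually_cmk (Ob_open hf)
  cover := by
    rintro ⟨f⟩
    exact exists_min_cover f
  pt := fun v => cmk (hom (clV v) 0 (repV hn v) 1)
  lab := labY
  lab_loc := by
    rintro b ⟨f⟩ hf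
    apply eventually_cmk (f := f)
    filter_upwards [sameType_eventually (show Ob b (rr f) from hf)] with g hg
    exact labc_congr hg.kk.symm
  H := fun b y t => HY b 0 y t
  H_cont := by
    rintro b ⟨⟨f⟩, t⟩ ⟨hf, _⟩
    exact (HY_contAt (good_zero (show Ob b (rr f) from hf)) (Or.inl rfl) t).continuousWithinAt
  H_mem := by
    rintro b ⟨f⟩ hf t
    exact (hom_good (good_zero (show Ob b (rr f) from hf)) t).2.2
  H_zero := by
    rintro b ⟨f⟩ hf
    change cmk (hom b 0 f 0) = cmk f
    rw [hom_zero]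
  H_one := by
    rintro b ⟨f⟩ hf
    change cmk (hom b 0 f 1) = cmk (hom (clV (labc b f)) 0 (repV hn (labc b f)) 1)
    have h1 := repV_Ob hn (labc b f)
    have h2 := repV_lab hn (labc b f)
    have h3 := cl_labc b f
    rw [h3] at h1 h2 ⊢
    exact target_eq (good_zero hf) (good_zero h1) (labc_inj hf h1 h2.symm) (Or.inl rfl)
  cl := clV
  pt_mem := fun v => (hom_good (good_zero (repV_Ob hn v)) 1).2.2
  pt_lab := by
    intro v
    refine (labc_congr (hom_sameType (good_zero (repV_Ob hn v)) 1).kk.symm).trans (repV_lab hn v)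
  pt_not := by
    intro v hv h
    change Ob false (rr (hom (clV v) 0 (repV hn v) 1)) at h
    have h1 := repV_Ob hn v
    obtain ⟨a, ha⟩ := Ob_true_iff.mp (hv ▸ h1)
    have := Ob_false_iff.mp h a
    rw [rr_hom (good_zero h1)] at this
    rw [← hv] at ha
    simp [xx, tg, ha] at this
  H_pt := by
    intro v t
    change cmk (hom (clV v) 0 (hom (clV v) 0 (repV hn v) 1) t) = _
    rw [hom_fixed (good_zero (repV_Ob hn v))]
  src := srcE
  tgt := tgtE hn
  cl_src := fun _ => rfl
  cl_tgt := fun _ => rfl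
  ε := epsY
  ε_loc := by
    rintro ⟨f⟩ hf
    apply eventually_cmk (f := f)
    filter_upwards [sameType_eventually (show Ob true (rr f) from hf true),
      sleg_loc (hf true) (hf false)] with g hg h2
    change epsc g = epsc f
    rw [epsc, epsc, h2, labc_congr hg.kk]
  ε_src := by
    rintro ⟨f⟩ hf
    change labc true f = srcE (epsc f)
    rw [srcE, epsc_fst (hf true), labc_true_eq (hf true)]
  ε_tgt := by
    rintro ⟨f⟩ hf
    exact eps_tgt hn (hf true)
  ε_conn := by
    rintro ⟨f⟩ ⟨g⟩ hf hg h
    exact conn_mid (hf true) (hf false) (hg true) (hg false) h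
  ε_surj := by
    rintro ⟨m, i⟩
    obtain ⟨f, h1, h2, h3, h4⟩ := exists_cfg hn m i
    refine ⟨cmk f, ?_, ?_⟩
    · rintro (_ | _)
      · exact h2
      · exact h1
    · change epsc f = _
      refine Prod.ext ?_ h4
      rw [epsc_fst h1]
      exact Subtype.ext h3

end StarVK
end GraphBraid
end

section
open unitInterval
namespace GraphBraid
open Topology CategoryTheory

set_option linter.unusedSectionVars false

theorem hockey (m e : ℕ) : ∑ j ∈ Finset.range e, Nat.choose (m + 1 + j) m +
    (Nat.choose (m + e + 1) m + 1) = Nat.choose (m + e + 2) (m + 1) := by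
  induction e with
  | zero => 
    simp
  | succ e ih =>
    rw [Finset.sum_range_succ, show m + (e+1) + 2 = (m + e + 2) + 1 by ring,
      Nat.choose_succ_succ (m+e+2) m, ← ih, show m + (e+1) + 1 = m + e + 2 by ring,
      show m + 1 + e = m + e + 1 by ring]
    omega

theorem rank_identity (n d : ℕ) (hn : 1 ≤ n) (hd : 3 ≤ d) :
    (∑ i ∈ Finset.Icc 2 (d - 1), (Nat.choose (n + d - 2) (n - 1) - Nat.choose (n + d - i - 1) (n - 1)))
      + (Nat.choose (d + n - 1) n + Nat.choose (d + (n - 1) - 1) (n - 1)) =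
    Nat.choose (d + (n - 1) - 1) (n - 1) * d + 1 := by
  obtain ⟨m, rfl⟩ : ∃ m, n = m + 1 := ⟨n - 1, by omega⟩
  obtain ⟨e, rfl⟩ : ∃ e, d = e + 2 := ⟨d - 2, by omega⟩
  have h1 : ∀ i ∈ Finset.Icc 2 (e + 1), Nat.choose (m + 1 + (e + 2) - i - 1) m ≤ Nat.choose (m + e + 1) m := by
    intro i hi
    apply Nat.choose_le_choose
    simp at hi; omega
  simp only [Nat.add_sub_cancel, show e + 2 - 1 = e + 1 by omega,
    show m + 1 + (e + 2) - 2 = m + e + 1 by omega, show e + 2 + (m + 1) - 1 = m + e + 2 by omega,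
    show e + 2 + m - 1 = m + e + 1 by omega]
  have h2 : ∑ i ∈ Finset.Icc 2 (e + 1), Nat.choose (m + 1 + (e + 2) - i - 1) m =
      ∑ j ∈ Finset.range e, Nat.choose (m + 1 + j) m := by
    refine Finset.sum_nbij' (fun i => e + 1 - i) (fun j => e + 1 - j) ?_ ?_ ?_ ?_ ?_
    · intro i hi; simp at hi ⊢; omega
    · intro i hi; simp at hi ⊢; omega
    · intro i hi; simp at hi ⊢; omega
    · intro i hi; simp at hi ⊢; omega
    · intro i hi; simp at hi; congr 1; omega
  have h3 : ∑ i ∈ Finset.Icc 2 (e + 1), (Nat.choose (m + e + 1) m - Nat.choose (m + 1 + (e + 2) - i - 1) m)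
     + ∑ j ∈ Finset.range e, Nat.choose (m + 1 + j) m = e * Nat.choose (m + e + 1) m := by
    rw [← h2, ← Finset.sum_add_distrib, Finset.sum_congr rfl (fun i hi => Nat.sub_add_cancel (h1 i hi))]
    simp
  have h4 := hockey m e
  have h5 : Nat.choose (m + e + 1) m * (e + 2) = e * Nat.choose (m + e + 1) m + 2 * Nat.choose (m + e + 1) m := by ring
  omega

section StarFree
open Classical
variable {N : Type} [Fintype N] [Nonempty N] {n : ℕ}

theorem VK.joined_edge {Y : Type} [TopologicalSpace Y] {V Eg : Type} (D : VK Y V Eg) (e : Eg) :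
    Joined (D.pt (D.src e)) (D.pt (D.tgt e)) := by
  have h1 : D.lab true (D.ye e) = D.src e := by rw [D.ε_src _ (D.ye_mem e), D.ye_ε]
  have h2 : D.lab false (D.ye e) = D.tgt e := by rw [D.ε_tgt _ (D.ye_mem e), D.ye_ε]
  exact ⟨(D.c true _ _ (D.ye_mem e _) h1).symm.trans (D.c false _ _ (D.ye_mem e _) h2)⟩

theorem cnt_conn {k : ℕ} (R : Cnt N k → Cnt N k → Prop) (hR : Equivalence R)
    (h : ∀ (m : N → ℕ) (i j : N) (h1 : ∑ x, (m + Pi.single i 1 : N → ℕ) x = k)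
      (h2 : ∑ x, (m + Pi.single j 1 : N → ℕ) x = k), R ⟨_, h1⟩ ⟨_, h2⟩) (a b : Cnt N k) : R a b := by
  let i0 : N := Classical.arbitrary N
  have key : ∀ q (a : Cnt N k), k - a.1 i0 = q → R a ⟨Pi.single i0 k, by simp⟩ := by
    intro q
    induction q with
    | zero =>
      intro a ha
      have : a = ⟨Pi.single i0 k, by simp⟩ := by
        apply Subtype.ext
        have h2 := a.2
        rw [← Finset.add_sum_erase _ _ (Finset.mem_univ i0)] at h2
        have h3 : ∑ x ∈ Finset.univ.erase i0, a.1 x = 0 := by omega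
        rw [Finset.sum_eq_zero_iff] at h3
        funext j
        by_cases hj : j = i0
        · subst hj; simp; omega
        · rw [h3 j (by simp [hj])]; simp [Pi.single_eq_of_ne hj]
      rw [this]
      exact hR.refl _
    | succ q ih =>
      intro a ha
      have : ∃ j, j ≠ i0 ∧ 0 < a.1 j := by
        by_contra hcon
        push Not at hcon
        have h2 := a.2
        rw [← Finset.add_sum_erase _ _ (Finset.mem_univ i0), Finset.sum_eq_zero (fun i hi =>
          Nat.le_zero.mp (hcon i (Finset.ne_of_mem_erase hi)))] at h2
        omega
      obtain ⟨j, hj, hj'⟩ := this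
      have hm : a.1 = (a.1 - Pi.single j 1 : N → ℕ) + Pi.single j 1 := by
        funext x
        by_cases h : x = j
        · subst h; simp; omega
        · simp [Pi.single_eq_of_ne h]
      have h1 : ∑ x, ((a.1 - Pi.single j 1 : N → ℕ) + Pi.single j 1 : N → ℕ) x = k := by
        rw [← hm]; exact a.2
      have h2 : ∑ x, ((a.1 - Pi.single j 1 : N → ℕ) + Pi.single i0 1 : N → ℕ) x = k := by
        refine Eq.trans ?_ h1
        simp only [Pi.add_apply, Finset.sum_add_distrib]
        simp
      have e : a = ⟨_, h1⟩ := Subtype.ext hm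
      have h3 := h _ j i0 h1 h2
      rw [← e] at h3
      refine hR.trans h3 (ih _ ?_)
      simp [Pi.single_eq_of_ne (Ne.symm hj)]
      omega
  exact hR.trans (key _ a rfl) (hR.symm (key _ b rfl))

theorem card_Cnt (k : ℕ) : Nat.card (Cnt N k) = (Fintype.card N + k - 1).choose k := by
  rw [← Nat.card_congr (Sym.equivNatSumOfFintype N k), Nat.card_eq_fintype_card,
    Sym.card_sym_eq_choose]

instance (k : ℕ) : Finite (Cnt N k) := Finite.of_equiv _ (Sym.equivNatSumOfFintype N k)

theorem star_conn (hn : 1 ≤ n) (v w) :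
    Joined ((starVK (N := N) hn).pt v) ((starVK (N := N) hn).pt w) := by
  have key : ∀ m (i : N), Joined ((starVK (N := N) hn).pt (.inr m)) ((starVK (N := N) hn).pt (tgtE hn (m, i))) :=
    fun m i => (starVK hn).joined_edge (m, i)
  have h1 : ∀ a b : Cnt N n, Joined ((starVK (N := N) hn).pt (.inl a)) ((starVK (N := N) hn).pt (.inl b)) := by
    refine cnt_conn (fun a b => Joined ((starVK (N := N) hn).pt (.inl a)) ((starVK (N := N) hn).pt (.inl b)))
      ⟨fun _ => Joined.refl _, fun h => h.symm, fun h h' => h.trans h'⟩ ?_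
    intro m i j h1 h2
    have hs : ∑ x, m x = n - 1 := by
      simp only [Pi.add_apply, Finset.sum_add_distrib] at h1
      have : ∑ x : N, (Pi.single i 1 : N → ℕ) x = 1 := by simp
      omega
    exact (key ⟨m, hs⟩ i).symm.trans (key ⟨m, hs⟩ j)
  have h2 : ∀ v : Cnt N n ⊕ Cnt N (n-1), Joined ((starVK (N := N) hn).pt v) ((starVK (N := N) hn).pt (.inl default)) := by
    rintro (a | a)
    · exact h1 _ _
    · exact (key a (Classical.arbitrary N)).trans (h1 _ _)
  exact (h2 v).trans (h2 w).symm

theorem star_free (hn : 1 ≤ n) (hd : 3 ≤ Nat.card N) (y : UConf n (Star N)) :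
    Nonempty (FundamentalGroup (UConf n (Star N)) y ≃* FreeGroup (Fin
      (∑ i ∈ Finset.Icc 2 (Nat.card N - 1), (Nat.choose (n + Nat.card N - 2) (n - 1) -
        Nat.choose (n + Nat.card N - i - 1) (n - 1))))) := by
  refine (starVK hn).free (star_conn hn) y _ ?_
  rw [Nat.card_sum, Nat.card_prod, card_Cnt, card_Cnt, ← Nat.card_eq_fintype_card]
  exact rank_identity n _ hn hd

end StarFree
end GraphBraid
end

section
open unitInterval
namespace GraphBraid
open Topology CategoryTheory

structure Spider {V : Type} (G : SimpleGraph V) (v₀ : V) where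
  h : V → ℕ
  lg : V → G.neighborSet v₀
  h_zero : ∀ v, h v = 0 ↔ v = v₀
  h_adj : ∀ u v, G.Adj u v → h v = h u + 1 ∨ h u = h v + 1
  lg_adj : ∀ u v, G.Adj u v → h v = h u + 1 → u ≠ v₀ → lg v = lg u
  lg_root : ∀ v (hv : G.Adj v₀ v), lg v = ⟨v, hv⟩
  parent : ∀ v, v ≠ v₀ → ∃ u, G.Adj u v ∧ h v = h u + 1
  parent_uniq : ∀ v u u', G.Adj u v → h v = h u + 1 → G.Adj u' v → h v = h u' + 1 → u = u'

open Classical in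
theorem exists_spider {V : Type} (G : SimpleGraph V) (hG : G.IsTree) (v₀ : V)
    [Nonempty (G.neighborSet v₀)] : Nonempty (Spider G v₀) := by
  choose P hP hP' using hG.existsUnique_path v₀
  have hPu : ∀ w (p : G.Walk v₀ w), p.IsPath → p = P w := hP'
  have dich : ∀ u v (h : G.Adj u v), P v = (P u).concat h ∨ P u = (P v).concat h.symm := by
    intro u v h
    by_cases hu : u ∈ (P v).support
    · exact Or.inl (hG.isAcyclic.path_concat (hP u) (hP v) h hu)
    · right
      exact hG.isAcyclic.path_concat (hP v) (hP u) h.symm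
        (hG.isAcyclic.mem_support_of_ne_mem_support_of_adj_of_isPath (hP u) (hP v) h hu)
  have ch : ∀ u v (h : G.Adj u v), (P v).length = (P u).length + 1 → P v = (P u).concat h := by
    intro u v h hl
    rcases dich u v h with h1 | h1
    · exact h1
    · have := congrArg SimpleGraph.Walk.length h1
      rw [SimpleGraph.Walk.length_concat] at this
      omega
  have hnil : ∀ v, v ≠ v₀ → ¬ (P v).Nil := fun v hv => SimpleGraph.Walk.not_nil_of_ne hv.symm
  have hroot : P v₀ = SimpleGraph.Walk.nil := (hPu v₀ _ SimpleGraph.Walk.IsPath.nil).symm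
  have hz : ∀ v, (P v).length = 0 ↔ v = v₀ := by
    intro v
    constructor
    · intro h; exact (SimpleGraph.Walk.eq_of_length_eq_zero h).symm
    · rintro rfl; rw [hroot]; rfl
  refine ⟨{
    h := fun v => (P v).length
    lg := fun v => if hv : v = v₀ then Classical.arbitrary _ else
      ⟨(P v).snd, SimpleGraph.Walk.adj_snd (hnil v hv)⟩
    h_zero := hz
    h_adj := ?_, lg_adj := ?_, lg_root := ?_, parent := ?_, parent_uniq := ?_ }⟩
  · intro u v h
    rcases dich u v h with h1 | h1
    · left; rw [h1]; simp
    · right; rw [h1]; simp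
  · intro u v h hl hu
    have h1 := ch u v h hl
    have hv : v ≠ v₀ := by
      rw [Ne, ← hz]; omega
    simp only [dif_neg hu, dif_neg hv]
    apply Subtype.ext
    change (P v).snd = (P u).snd
    rw [h1]
    have h0 : (P u).length ≠ 0 := fun h => hu ((hz u).mp h)
    rw [SimpleGraph.Walk.snd, SimpleGraph.Walk.snd, SimpleGraph.Walk.concat,
      SimpleGraph.Walk.getVert_append]
    split_ifs with h2
    · rfl
    · have : (P u).length = 1 := by omega
      simp [this]
      rw [← this, SimpleGraph.Walk.getVert_length]
  · intro v hv
    have : v ≠ v₀ := hv.ne'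
    simp only [dif_neg this]
    apply Subtype.ext
    change (P v).snd = v
    have h1 : P v = (P v₀).concat hv := by
      rcases dich v₀ v hv with h1 | h1
      · exact h1
      · have := congrArg SimpleGraph.Walk.length h1
        rw [hroot] at this
        simp at this
    rw [h1, hroot]
    rfl
  · intro v hv
    have ha := SimpleGraph.Walk.adj_penultimate (hnil v hv)
    have h2 : (P v).dropLast = P _ := hPu _ _ (by
      have := hP v
      rw [← SimpleGraph.Walk.concat_dropLast ha] at this
      exact ((SimpleGraph.Walk.concat_isPath_iff _).mp this).1)
    refine ⟨_, ha, ?_⟩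
    rw [← h2]
    have h0 : (P v).length ≠ 0 := fun h => hv ((hz v).mp h)
    simp
    omega
  · intro v u u' h hl h' hl'
    have h1 := ch u v h hl
    have h2 := ch u' v h' hl'
    rw [h1] at h2
    have := congrArg SimpleGraph.Walk.penultimate h2
    simpa using this
end GraphBraid
end

section
open unitInterval
namespace GraphBraid
open Topology CategoryTheory
set_option linter.unusedSectionVars false

section SpiderSec
open Classical
variable {V : Type} [Fintype V] {G : SimpleGraph V} {v₀ : V} (S : Spider G v₀)

namespace Spider

theorem ne_root {u v : V} (h : S.h v = S.h u + 1) : v ≠ v₀ := by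
  rw [Ne, ← S.h_zero]; omega

theorem vertex_uniq (hdeg : ∀ w : V, 3 ≤ (G.neighborSet w).ncard → w = v₀) : ∀ (k : ℕ) (v w : V), S.h v = k → S.h w = k → v ≠ v₀ → w ≠ v₀ →
    S.lg v = S.lg w → v = w := by
  intro k
  induction k with
  | zero => intro v w h1 _ h2; exact absurd ((S.h_zero v).mp h1) h2
  | succ k ih =>
    intro v w hv hw hv0 hw0 hl
    obtain ⟨p, hp, hp'⟩ := S.parent v hv0
    obtain ⟨q, hq, hq'⟩ := S.parent w hw0
    by_cases hk : k = 0
    · have e1 : p = v₀ := (S.h_zero p).mp (by omega)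
      have e2 : q = v₀ := (S.h_zero q).mp (by omega)
      subst e1
      subst e2
      rw [S.lg_root v hp, S.lg_root w hq] at hl
      exact congrArg Subtype.val hl
    · have hp0 : p ≠ v₀ := by rw [Ne, ← S.h_zero]; omega
      have hq0 : q ≠ v₀ := by rw [Ne, ← S.h_zero]; omega
      have e : p = q := ih p q (by omega) (by omega) hp0 hq0 (by
        rw [← S.lg_adj p v hp hp' hp0, ← S.lg_adj q w hq hq' hq0, hl])
      subst e
      by_contra hne
      obtain ⟨r, hr, hr'⟩ := S.parent p hp0
      refine hp0 (hdeg p ?_)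
      have hsub : ({r, v, w} : Set V) ⊆ G.neighborSet p := by
        rintro x (rfl | rfl | rfl)
        · exact hr.symm
        · exact hp
        · exact hq
      have h3 : ({r, v, w} : Set V).ncard = 3 := by
        rw [Set.ncard_eq_three]
        refine ⟨r, v, w, ?_, ?_, hne, rfl⟩
        · rintro rfl; omega
        · rintro rfl; omega
      rw [← h3]
      exact Set.ncard_le_ncard hsub (Set.toFinite _)

theorem exists_L : ∃ L : G.neighborSet v₀ → ℕ, (∀ v, v ≠ v₀ → S.h v ≤ L (S.lg v)) ∧
    ∀ i, 1 ≤ L i ∧ ∃ v, v ≠ v₀ ∧ S.lg v = i ∧ S.h v = L i := by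
  have : ∀ i : G.neighborSet v₀, ∃ v, (v ≠ v₀ ∧ S.lg v = i) ∧ ∀ w, w ≠ v₀ → S.lg w = i → S.h w ≤ S.h v := by
    intro i
    obtain ⟨v, hv, hm⟩ := Finset.exists_max_image (Finset.univ.filter fun v => v ≠ v₀ ∧ S.lg v = i) S.h
      ⟨i.1, by simp [S.lg_root i.1 i.2]; exact (G.ne_of_adj i.2).symm⟩
    simp only [Finset.mem_filter, Finset.mem_univ, true_and] at hv hm
    exact ⟨v, hv, fun w h1 h2 => hm w ⟨h1, h2⟩⟩
  choose f hf hf' using this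
  refine ⟨fun i => S.h (f i), fun v hv => hf' _ v hv rfl, fun i => ⟨?_, f i, (hf i).1, (hf i).2, rfl⟩⟩
  have := mt (S.h_zero (f i)).mp (hf i).1
  change 1 ≤ S.h (f i)
  omega

noncomputable def L : G.neighborSet v₀ → ℕ := S.exists_L.choose
theorem le_L {v : V} (hv : v ≠ v₀) : S.h v ≤ S.L (S.lg v) := S.exists_L.choose_spec.1 v hv
theorem one_le_L (i : G.neighborSet v₀) : 1 ≤ S.L i := (S.exists_L.choose_spec.2 i).1
theorem exists_vertex (i : G.neighborSet v₀) (k : ℕ) (hk : 1 ≤ k) (hk' : k ≤ S.L i) :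
    ∃ v, v ≠ v₀ ∧ S.lg v = i ∧ S.h v = k := by
  refine Nat.decreasingInduction' (P := fun k => ∃ v, v ≠ v₀ ∧ S.lg v = i ∧ S.h v = k) ?_ hk'
    (S.exists_L.choose_spec.2 i).2
  rintro j _ hj ⟨v, hv, hl, hh⟩
  obtain ⟨p, hp, hp'⟩ := S.parent v hv
  have hp0 : p ≠ v₀ := by rw [Ne, ← S.h_zero]; omega
  exact ⟨p, hp0, (S.lg_adj p v hp hp' hp0).symm.trans hl, by omega⟩

/-- position of a vertex in the star -/
noncomputable def pos (v : V) : G.neighborSet v₀ → ℝ := Pi.single (S.lg v) (S.h v / S.L (S.lg v))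

theorem pos_root : S.pos v₀ = 0 := by
  rw [pos, (S.h_zero v₀).mpr rfl]; simp

theorem pos_parent {u v : V} (h : G.Adj u v) (hh : S.h v = S.h u + 1) :
    S.pos u = Pi.single (S.lg v) (S.h u / S.L (S.lg v) : ℝ) := by
  by_cases hu : u = v₀
  · subst hu; rw [pos_root, (S.h_zero _).mpr rfl]; simp
  · rw [pos, S.lg_adj u v h hh hu]

noncomputable def F (x : Σ _ : EdgeIdx G, I) : G.neighborSet v₀ → ℝ :=
  (1 - (x.2 : ℝ)) • S.pos x.1.1.1 + (x.2 : ℝ) • S.pos x.1.1.2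

theorem F_glue (x y : Σ _ : EdgeIdx G, I) (h : GlueRel G x y) : S.F x = S.F y := by
  unfold F
  rcases h with ⟨h1, h2, h3⟩ | ⟨h1, h2, h3⟩
  · rw [h1, h2, h3, add_comm]; congr 2; ring
  · rw [h1, h2, h3]; simp

theorem F_child {u v : V} (h : G.Adj u v) (hh : S.h v = S.h u + 1) (t : I) :
    S.F ⟨⟨(u, v), h⟩, t⟩ = Pi.single (S.lg v) ((S.h u + (t : ℝ)) / S.L (S.lg v)) := by
  unfold F
  simp only
  rw [S.pos_parent h hh, pos, hh, ← Pi.single_smul, ← Pi.single_smul, ← Pi.single_add]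
  congr 1
  push_cast
  simp only [smul_eq_mul]
  ring

/-- the flip -/
theorem glue_flip {u v : V} (h : G.Adj u v) (t : I) :
    (Quot.mk (GlueRel G) ⟨⟨(u, v), h⟩, t⟩ : Realization G) = Quot.mk _ ⟨⟨(v, u), h.symm⟩, σ t⟩ := by
  apply Quot.sound
  left
  exact ⟨rfl, rfl, by simp⟩

theorem glue_zero {u v w : V} (h : G.Adj u v) (h' : G.Adj u w) :
    (Quot.mk (GlueRel G) ⟨⟨(u, v), h⟩, 0⟩ : Realization G) = Quot.mk _ ⟨⟨(u, w), h'⟩, 0⟩ := by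
  apply Quot.sound
  right
  exact ⟨rfl, rfl, rfl⟩

theorem rep_child (x : Realization G) : ∃ u v, ∃ h : G.Adj u v, ∃ t : I, S.h v = S.h u + 1 ∧
    (0 < (t : ℝ) ∨ (u = v₀ ∧ t = 0)) ∧ x = Quot.mk _ ⟨⟨(u, v), h⟩, t⟩ := by
  have h1 : ∃ u v, ∃ h : G.Adj u v, ∃ t : I, S.h v = S.h u + 1 ∧ x = Quot.mk _ ⟨⟨(u, v), h⟩, t⟩ := by
    obtain ⟨⟨⟨⟨u, v⟩, h⟩, t⟩⟩ := x
    rcases S.h_adj u v h with h1 | h1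
    · exact ⟨u, v, h, t, h1, rfl⟩
    · exact ⟨v, u, SimpleGraph.Adj.symm h, σ t, h1, glue_flip h t⟩
  obtain ⟨u, v, h, t, hh, hx⟩ := h1
  by_cases ht : 0 < (t : ℝ)
  · exact ⟨u, v, h, t, hh, Or.inl ht, hx⟩
  have ht0 : t = 0 := Subtype.ext (le_antisymm (not_lt.mp ht) t.2.1)
  subst ht0
  by_cases hu : u = v₀
  · exact ⟨u, v, h, 0, hh, Or.inr ⟨hu, rfl⟩, hx⟩
  obtain ⟨p, hp, hp'⟩ := S.parent u hu
  refine ⟨p, u, hp, 1, hp', Or.inl (by simp), ?_⟩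
  rw [hx, glue_zero h hp.symm, glue_flip hp.symm]
  simp

theorem L_pos (i : G.neighborSet v₀) : (0 : ℝ) < S.L i := by
  exact_mod_cast S.one_le_L i

theorem F_mem (x : Σ _ : EdgeIdx G, I) : (∀ i, 0 ≤ S.F x i ∧ S.F x i ≤ 1) ∧
    ∀ i j, S.F x i ≠ 0 → S.F x j ≠ 0 → i = j := by
  obtain ⟨u, v, h, t, hh, _, hx⟩ := S.rep_child (Quot.mk _ x)
  have e : S.F x = S.F ⟨⟨(u, v), h⟩, t⟩ := congrArg (Quot.lift S.F S.F_glue) hx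
  rw [e, S.F_child h hh]
  have hv := S.ne_root hh
  have h1 : (0 : ℝ) ≤ (S.h u + (t : ℝ)) / S.L (S.lg v) := by
    have := t.2.1
    positivity
  have h2 : (S.h u + (t : ℝ)) / S.L (S.lg v) ≤ 1 := by
    rw [div_le_one (S.L_pos _)]
    have : ((S.h v : ℕ) : ℝ) ≤ S.L (S.lg v) := by exact_mod_cast S.le_L hv
    rw [hh] at this
    push_cast at this
    linarith [t.2.2]
  constructor
  · intro i
    by_cases hi : i = S.lg v
    · rw [hi]; simpa using ⟨h1, h2⟩
    · rw [Pi.single_eq_of_ne hi]; simp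
  · intro i j hi hj
    have e1 : i = S.lg v := by
      by_contra hc; exact hi (Pi.single_eq_of_ne hc _)
    have e2 : j = S.lg v := by
      by_contra hc; exact hj (Pi.single_eq_of_ne hc _)
    rw [e1, e2]

noncomputable def Phi : Realization G → Star (G.neighborSet v₀) :=
  Quot.lift (fun x => (⟨S.F x, S.F_mem x⟩ : Star (G.neighborSet v₀))) (fun x y h => Subtype.ext (S.F_glue x y h))

theorem Phi_val (x) : (S.Phi (Quot.mk _ x)).1 = S.F x := rfl

theorem Phi_cont : Continuous S.Phi := by
  refine continuous_quot_lift _ ?_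
  refine Continuous.subtype_mk ?_ _
  refine continuous_sigma fun e => ?_
  have h : ∀ p q : G.neighborSet v₀ → ℝ, Continuous fun t : I => (1 - (t : ℝ)) • p + (t : ℝ) • q := by
    intro p q; fun_prop
  exact h (S.pos e.1.1) (S.pos e.1.2)

theorem Phi_inj (hdeg : ∀ w : V, 3 ≤ (G.neighborSet w).ncard → w = v₀) : Function.Injective S.Phi := by
  intro x y hxy
  obtain ⟨u, v, h, t, hh, ht, rfl⟩ := S.rep_child x
  obtain ⟨u', v', h', t', hh', ht', rfl⟩ := S.rep_child y
  have e := congrArg Subtype.val hxy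
  rw [Phi_val, Phi_val, S.F_child h hh, S.F_child h' hh'] at e
  have hL := S.L_pos (S.lg v)
  have hL' := S.L_pos (S.lg v')
  rcases ht with ht | ⟨hu, ht⟩
  · have hp : 0 < (S.h u + (t : ℝ)) / S.L (S.lg v) := by positivity
    have e1 := congrFun e (S.lg v)
    rw [Pi.single_eq_same] at e1
    have hl : S.lg v = S.lg v' := by
      by_contra hc
      rw [Pi.single_eq_of_ne hc] at e1
      exact hp.ne' e1
    rw [← hl, Pi.single_eq_same, div_left_inj' hL.ne'] at e1
    have ht' : 0 < (t' : ℝ) := by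
      rcases ht' with ht' | ⟨hu', ht'⟩
      · exact ht'
      · rw [hu', ht', (S.h_zero v₀).mpr rfl] at e1
        simp at e1
        have : (0 : ℝ) ≤ S.h u := by positivity
        linarith
    have hk : S.h u = S.h u' := by
      have a1 : (S.h u : ℝ) < S.h u' + 1 := by linarith [t'.2.2]
      have a2 : (S.h u' : ℝ) < S.h u + 1 := by linarith [t.2.2]
      have a1 : S.h u < S.h u' + 1 := by exact_mod_cast a1
      have a2 : S.h u' < S.h u + 1 := by exact_mod_cast a2
      omega
    have htt : t = t' := by
      rw [hk] at e1
      exact Subtype.ext (by linarith)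
    have hv : v = v' := S.vertex_uniq hdeg _ v v' rfl (by omega) (S.ne_root hh) (S.ne_root hh') hl
    subst hv
    have hu := S.parent_uniq v u u' h hh h' hh'
    subst hu
    rw [htt]
  · subst hu
    subst ht
    rw [(S.h_zero _).mpr rfl] at e
    simp at e
    have e1 := congrFun e (S.lg v')
    rw [Pi.single_eq_same] at e1
    rcases ht' with ht' | ⟨hu', ht'⟩
    · have hp : 0 < (S.h u' + (t' : ℝ)) / S.L (S.lg v') := by positivity
      exact absurd e1.symm hp.ne'
    · subst hu'
      subst ht'
      exact glue_zero h h'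

theorem Phi_surj [Nonempty (G.neighborSet v₀)] : Function.Surjective S.Phi := by
  intro x
  obtain ⟨h0, h1⟩ := rad_mem x
  by_cases hr : rad x = 0
  · obtain ⟨i⟩ := (inferInstance : Nonempty (G.neighborSet v₀))
    refine ⟨Quot.mk _ ⟨⟨(v₀, i.1), i.2⟩, 0⟩, ?_⟩
    apply Subtype.ext
    rw [Phi_val, star_eq x, hr, sp_val _ le_rfl zero_le_one]
    simp [F, pos_root]
  · have hr : 0 < rad x := lt_of_le_of_ne h0 (Ne.symm hr)
    have hL := S.L_pos (leg x)
    have hp : 0 < rad x * S.L (leg x) := by positivity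
    obtain ⟨k, hk⟩ : ∃ k, ⌈rad x * S.L (leg x)⌉₊ = k + 1 := ⟨⌈rad x * S.L (leg x)⌉₊ - 1, by
      have := Nat.ceil_pos.mpr hp
      omega⟩
    have hk1 : k + 1 ≤ S.L (leg x) := by
      rw [← hk, Nat.ceil_le]
      nlinarith
    have b1 : rad x * S.L (leg x) ≤ k + 1 := by
      have := Nat.le_ceil (rad x * S.L (leg x))
      rw [hk] at this
      exact_mod_cast this
    have b2 : (k : ℝ) < rad x * S.L (leg x) := by
      apply Nat.lt_ceil.mp
      omega
    obtain ⟨v, hv, hl, hh⟩ := S.exists_vertex (leg x) (k + 1) (by omega) hk1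
    obtain ⟨u, hu, hu'⟩ := S.parent v hv
    refine ⟨Quot.mk _ ⟨⟨(u, v), hu⟩, ⟨rad x * S.L (leg x) - k, by linarith, by linarith⟩⟩, ?_⟩
    apply Subtype.ext
    have : S.h u = k := by omega
    have hx : x.1 = Pi.single (leg x) (rad x) := by
      conv_lhs => rw [star_eq x]
      rw [sp_val _ h0 h1]
      congr!
    rw [Phi_val, S.F_child hu hu', hx, hl, this]
    congr 1
    simp only
    rw [add_sub_cancel, mul_div_assoc, div_self hL.ne', mul_one]

end Spider

instance : Finite (EdgeIdx G) := inferInstanceAs (Finite {p : V × V // G.Adj p.1 p.2})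

theorem exists_homeo (S : Spider G v₀) (hdeg : ∀ w : V, 3 ≤ (G.neighborSet w).ncard → w = v₀)
    [Nonempty (G.neighborSet v₀)] :
    Nonempty (Realization G ≃ₜ Star (G.neighborSet v₀)) :=
  ⟨S.Phi_cont.homeoOfEquivCompactToT2 (f := Equiv.ofBijective _ ⟨S.Phi_inj hdeg, S.Phi_surj⟩)⟩

end SpiderSec

/-- the configuration space functor on homeomorphisms -/
def confMap (n : ℕ) {X Y : Type} [TopologicalSpace X] [TopologicalSpace Y] (e : X ≃ₜ Y) :
    C(UConf n X, UConf n Y) where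
  toFun := Quot.map (fun f => ⟨e ∘ f.1, e.injective.comp f.2⟩) (by
    rintro x y ⟨p, hp⟩
    refine ⟨p, ?_⟩
    change (e ∘ x.1) ∘ p = e ∘ y.1
    rw [← hp]; rfl)
  continuous_toFun := by
    refine continuous_quot_lift _ (continuous_quot_mk.comp ?_)
    refine Continuous.subtype_mk ?_ _
    exact continuous_pi fun a => e.continuous.comp ((continuous_apply a).comp continuous_subtype_val)

def confHomeo (n : ℕ) {X Y : Type} [TopologicalSpace X] [TopologicalSpace Y] (e : X ≃ₜ Y) :
    UConf n X ≃ₜ UConf n Y where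
  toFun := confMap n e
  invFun := confMap n e.symm
  left_inv := by
    rintro ⟨f⟩
    refine congrArg (Quot.mk _) (Subtype.ext ?_)
    funext a
    exact e.symm_apply_apply _
  right_inv := by
    rintro ⟨f⟩
    refine congrArg (Quot.mk _) (Subtype.ext ?_)
    funext a
    exact e.apply_symm_apply _
  continuous_toFun := (confMap n e).continuous
  continuous_invFun := (confMap n e.symm).continuous

theorem fundGroup_homeo {X Y : Type} [TopologicalSpace X] [TopologicalSpace Y] (e : X ≃ₜ Y) (x : X) :
    ∃ y : Y, Nonempty (FundamentalGroup X x ≃* FundamentalGroup Y y) := by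
  let E := FundamentalGroupoidFunctor.equivOfHomotopyEquiv e.toHomotopyEquiv
  exact ⟨(E.functor.obj (FundamentalGroupoid.mk x)).as,
    ⟨(Functor.FullyFaithful.ofFullyFaithful E.functor).mulEquivEnd (FundamentalGroupoid.mk x)⟩⟩

theorem main12 {V : Type} [Fintype V] (G : SimpleGraph V) (hG : G.IsTree)
    (v₀ : V) (hv₀ : 3 ≤ (G.neighborSet v₀).ncard)
    (huniq : ∀ w : V, 3 ≤ (G.neighborSet w).ncard → w = v₀)
    (n : ℕ) (hn : 1 ≤ n) (x₀ : UConf n (Realization G)) :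
    Nonempty (FundamentalGroup (UConf n (Realization G)) x₀ ≃*
      FreeGroup (Fin (∑ i ∈ Finset.Icc 2 ((G.neighborSet v₀).ncard - 1),
        (Nat.choose (n + (G.neighborSet v₀).ncard - 2) (n - 1) -
          Nat.choose (n + (G.neighborSet v₀).ncard - i - 1) (n - 1))))) := by
  classical
  have hne : (G.neighborSet v₀).Nonempty := Set.nonempty_of_ncard_ne_zero (by omega)
  have : Nonempty (G.neighborSet v₀) := hne.to_subtype
  have : Fintype (G.neighborSet v₀) := Fintype.ofFinite _
  obtain ⟨S⟩ := exists_spider G hG v₀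
  obtain ⟨e⟩ := exists_homeo S huniq
  obtain ⟨y, ⟨g⟩⟩ := fundGroup_homeo (confHomeo n e) x₀
  obtain ⟨k⟩ := star_free hn (N := G.neighborSet v₀) (by rwa [Nat.card_coe_set_eq]) y
  rw [Nat.card_coe_set_eq] at k
  exact ⟨g.trans k⟩
end GraphBraid
end

namespace GraphBraid

/-- If `Γ` is a finite tree with exactly one vertex of degree at least 3, of degree `d`,
then for every `n ≥ 1` the braid group `B_n|Γ| = π₁(UC^n(|Γ|))` is a free group of rank
`Σ_{i=2}^{d-1} [C(n + d - 2, n - 1) - C(n + d - i - 1, n - 1)]`. -/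
theorem stmt12 {V : Type} [Fintype V] [DecidableEq V] (G : SimpleGraph V) (hG : G.IsTree)
    (v₀ : V) (hv₀ : 3 ≤ (G.neighborSet v₀).ncard)
    (huniq : ∀ w : V, 3 ≤ (G.neighborSet w).ncard → w = v₀)
    (n : ℕ) (hn : 1 ≤ n) (x₀ : UConf n (Realization G)) :
    Nonempty (FundamentalGroup (UConf n (Realization G)) x₀ ≃*
      FreeGroup (Fin (∑ i ∈ Finset.Icc 2 ((G.neighborSet v₀).ncard - 1),
        (Nat.choose (n + (G.neighborSet v₀).ncard - 2) (n - 1) -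
          Nat.choose (n + (G.neighborSet v₀).ncard - i - 1) (n - 1))))) := by
  exact main12 G hG v₀ hv₀ huniq n hn x₀

end GraphBraid
end
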